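/- arXiv:2211.08283 — 13 statements merged into one kernel-verified Lean document; each statement's English description precedes it below -/
import Mathlib

section
/- Let (G,c) be a red-blue colored graph that is triangle-free and twin-free, with color classes R (the red vertices) and B (the blue vertices). Then sepRB(G,c) ≤ 3·min{|R|,|B|}. -/
/-- The closed neighborhood `N[v]` of a vertex `v`. -/
def closedNbhd {V : Type*} (G : SimpleGraph V) (v : V) : Set V :=
  {u | G.Adj v u ∨ u = v}

/-- A graph is twin-free if distinct vertices have distinct closed neighborhoods. -/
def TwinFree {V : Type*} (G : SimpleGraph V) : Prop :=
  ∀ u v : V, u ≠ v → closedNbhd G u ≠ closedNbhd G v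

/-- `S` is a red-blue separating set of `(G, c)`, where `c v = true` means `v` is red
and `c v = false` means `v` is blue. -/
def IsRBSep {V : Type*} (G : SimpleGraph V) (c : V → Bool) (S : Set V) : Prop :=
  ∀ r b : V, c r = true → c b = false →
    closedNbhd G r ∩ S ≠ closedNbhd G b ∩ S

/-- `sepRB (G, c)`: the minimum size of a red-blue separating set of `(G, c)`. -/
noncomputable def sepRB {V : Type*} [Fintype V] (G : SimpleGraph V) (c : V → Bool) : ℕ :=
  sInf {m | ∃ S : Finset V, S.card = m ∧ IsRBSep G c ↑S}

/-- `maxsepRB G`: the maximum over all red-blue colorings `c` of `sepRB (G, c)`. -/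
noncomputable def maxsepRB {V : Type*} [Fintype V] (G : SimpleGraph V) : ℕ :=
  sSup (Set.range fun c : V → Bool => sepRB G c)

/-- `S` is a (non-colored) separating set of `G`. -/
def IsSep {V : Type*} (G : SimpleGraph V) (S : Set V) : Prop :=
  ∀ u v : V, u ≠ v → closedNbhd G u ∩ S ≠ closedNbhd G v ∩ S

/-- `sep G`: the minimum size of a separating set of `G`. -/
noncomputable def sepNum {V : Type*} [Fintype V] (G : SimpleGraph V) : ℕ :=
  sInf {m | ∃ S : Finset V, S.card = m ∧ IsSep G ↑S}

theorem exists_local_sep {V : Type*} (G : SimpleGraph V)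
    (htriangle : G.CliqueFree 3) (htwin : TwinFree G) (r : V) :
    ∃ T : Finset V, T.card ≤ 2 ∧
      ∀ b, G.Adj r b → ∃ x ∈ T, ¬ (x ∈ closedNbhd G r ↔ x ∈ closedNbhd G b) := by
  classical
  have htri : ∀ a b c, G.Adj a b → G.Adj a c → G.Adj b c → False := by
    intro a b c h1 h2 h3
    exact htriangle {a, b, c} (SimpleGraph.is3Clique_triple_iff.2 ⟨h1, h2, h3⟩)
  by_cases h : ∃ b₁ b₂, b₁ ≠ b₂ ∧ G.Adj r b₁ ∧ G.Adj r b₂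
  · obtain ⟨b₁, b₂, hne, h1, h2⟩ := h
    refine ⟨{b₁, b₂}, Finset.card_le_two, ?_⟩
    intro b hb
    by_cases hbb : b = b₁
    · refine ⟨b₂, by simp, ?_⟩
      intro hiff
      have h3 : b₂ ∈ closedNbhd G b := hiff.1 (Or.inl h2)
      rcases h3 with h3 | h3
      · exact htri r b b₂ hb h2 h3
      · exact hne (hbb.symm.trans h3.symm)
    · refine ⟨b₁, by simp, ?_⟩
      intro hiff
      have h3 : b₁ ∈ closedNbhd G b := hiff.1 (Or.inl h1)
      rcases h3 with h3 | h3
      · exact htri r b b₁ hb h1 h3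
      · exact hbb h3.symm
  · push Not at h
    by_cases hn : ∃ b, G.Adj r b
    · obtain ⟨b, hb⟩ := hn
      have hx : ∃ x, ¬ (x ∈ closedNbhd G r ↔ x ∈ closedNbhd G b) := by
        by_contra hcon
        push Not at hcon
        exact htwin r b hb.ne (Set.ext hcon)
      obtain ⟨x, hx⟩ := hx
      refine ⟨{x}, by simp, ?_⟩
      intro b' hb'
      by_cases hbb : b = b'
      · subst hbb
        exact ⟨x, by simp, hx⟩
      · exact absurd hb' (h b b' hbb hb)
    · exact ⟨∅, by simp, fun b hb => absurd ⟨b, hb⟩ hn⟩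

theorem exists_color_sep {V : Type*} [Fintype V] (G : SimpleGraph V) (c : V → Bool)
    (htriangle : G.CliqueFree 3) (htwin : TwinFree G) (k : Bool) :
    ∃ S : Finset V, S.card ≤ 3 * (Finset.univ.filter fun v => c v = k).card ∧
      ∀ r b : V, c r = k → c b ≠ k → closedNbhd G r ∩ S ≠ closedNbhd G b ∩ S := by
  classical
  choose T hT hsep using exists_local_sep G htriangle htwin
  refine ⟨(Finset.univ.filter fun v => c v = k).biUnion fun r => insert r (T r), ?_, ?_⟩
  · rw [mul_comm]
    refine Finset.card_biUnion_le_card_mul _ _ _ fun r _ => ?_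
    have := Finset.card_insert_le r (T r)
    have := hT r
    omega
  · intro r b hr hb heq
    have key : ∀ x ∈ insert r (T r), (x ∈ closedNbhd G r ↔ x ∈ closedNbhd G b) := by
      intro x hx
      have hxS : x ∈ (((Finset.univ.filter fun v => c v = k).biUnion
          fun r => insert r (T r) : Finset V) : Set V) := by
        rw [Finset.mem_coe, Finset.mem_biUnion]
        exact ⟨r, by simp [hr], hx⟩
      have h := Set.ext_iff.1 heq x
      exact ⟨fun h' => (h.1 ⟨h', hxS⟩).1, fun h' => (h.2 ⟨h', hxS⟩).1⟩
    have hrb : r ∈ closedNbhd G b := (key r (by simp)).1 (Or.inr rfl)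
    rcases hrb with hrb | hrb
    · obtain ⟨x, hx, hx'⟩ := hsep r b hrb.symm
      exact hx' (key x (Finset.mem_insert_of_mem hx))
    · exact hb (hrb ▸ hr)

theorem stmt0 {V : Type*} [Fintype V] (G : SimpleGraph V) (c : V → Bool)
    (htriangle : G.CliqueFree 3) (htwin : TwinFree G) :
    sepRB G c ≤ 3 * min ((Finset.univ.filter fun v => c v = true).card)
      ((Finset.univ.filter fun v => c v = false).card) := by
  rcases min_choice ((Finset.univ.filter fun v => c v = true).card)
      ((Finset.univ.filter fun v => c v = false).card) with h | h
  · rw [h]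
    obtain ⟨S, hS, hsep⟩ := exists_color_sep G c htriangle htwin true
    refine le_trans (Nat.sInf_le ⟨S, rfl, fun r b hr hb => hsep r b hr (by simp [hb])⟩) hS
  · rw [h]
    obtain ⟨S, hS, hsep⟩ := exists_color_sep G c htriangle htwin false
    refine le_trans (Nat.sInf_le ⟨S, rfl, fun r b hr hb => (hsep b r hb (by simp [hr])).symm⟩) hS
end

section
/- For any twin-free graph G of order n ≥ 1 with n ∉ {8, 9, 16, 17}, one has maxsepRB(G) ≥ ⌊log₂(n)⌋. -/
theorem choose_lt_of_base (j n0 d : ℕ) (hj : 2 * j ≤ n0) (h1 : 1 ≤ j) (hd : n0 = d + 2 ^ j)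
    (hb : n0.choose j < 2 ^ d) (e : ℕ) : (n0 + e).choose j < 2 ^ (d + e) := by
  induction e with
  | zero => simpa using hb
  | succ e ih =>
    obtain ⟨i, rfl⟩ : ∃ i, j = i + 1 := ⟨j - 1, by omega⟩
    have h := Nat.choose_succ_succ (n0 + e) i
    have h2 : (n0 + e).choose i ≤ (n0 + e).choose (i + 1) :=
      Nat.choose_le_succ_of_lt_half_left (by omega)
    rw [← add_assoc, ← add_assoc, pow_succ]
    simp only [Nat.succ_eq_add_one] at h
    omega

theorem sq_le_two_pow (j : ℕ) (h : 6 ≤ j) : (j + 2) * j ≤ 2 ^ j := by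
  induction j, h using Nat.le_induction with
  | base => norm_num
  | succ j hj ih => rw [pow_succ]; nlinarith

theorem arith_choose (n j : ℕ) (h1 : 2 ^ (j + 1) ≤ n) (h2 : n < 2 ^ (j + 2))
    (hexc : n ∉ ({8, 9, 16, 17} : Set ℕ)) (h4 : n ≠ 4) :
    n.choose j < 2 ^ (n - 2 ^ j) := by
  simp only [Set.mem_insert_iff, Set.mem_singleton_iff, not_or] at hexc
  obtain ⟨e8, e9, e16, e17⟩ := hexc
  have key : ∀ n0 d : ℕ, 2 * j ≤ n0 → 1 ≤ j → n0 = d + 2 ^ j → n0.choose j < 2 ^ d → n0 ≤ n →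
      n.choose j < 2 ^ (n - 2 ^ j) := by
    intro n0 d a b c f g
    have := choose_lt_of_base j n0 d a b c f (n - n0)
    rwa [show n0 + (n - n0) = n by omega, show d + (n - n0) = n - 2 ^ j by omega] at this
  by_cases hj : 6 ≤ j
  · calc n.choose j ≤ n ^ j := Nat.choose_le_pow n j
      _ < (2 ^ (j + 2)) ^ j := Nat.pow_lt_pow_left h2 (by omega)
      _ = 2 ^ ((j + 2) * j) := by rw [← pow_mul]
      _ ≤ 2 ^ (n - 2 ^ j) := by
        apply Nat.pow_le_pow_right (by norm_num)
        have := sq_le_two_pow j hj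
        rw [pow_succ] at h1
        omega
  · have hj : j < 6 := by omega
    interval_cases j
    · simp at h1 ⊢
      omega
    · exact key 5 3 (by norm_num) (by norm_num) (by norm_num) (by decide) (by omega)
    · exact key 10 6 (by norm_num) (by norm_num) (by norm_num) (by decide) (by omega)
    · exact key 18 10 (by norm_num) (by norm_num) (by norm_num) (by norm_num [Nat.choose]) (by omega)
    · exact key 32 16 (by norm_num) (by norm_num) (by norm_num) (by norm_num [Nat.choose]) (by omega)
    · exact key 64 32 (by norm_num) (by norm_num) (by norm_num) (by norm_num [Nat.choose]) (by omega)

theorem arith_main (n j : ℕ) (h1 : 2 ^ (j + 1) ≤ n) (h2 : n < 2 ^ (j + 2))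
    (hexc : n ∉ ({8, 9, 16, 17} : Set ℕ)) :
    n.choose j * (2 ^ (2 ^ j) - 2) < 2 ^ n - 2 := by
  by_cases h4 : n = 4
  · subst h4
    have : j = 1 := by
      have a : j + 1 ≤ 2 := (Nat.pow_le_pow_iff_right (a := 2) (by norm_num)).1 (by simpa using h1)
      have b : 2 < j + 2 := (Nat.pow_lt_pow_iff_right (a := 2) (by norm_num)).1 (by simpa using h2)
      omega
    subst this
    norm_num
  · have h := arith_choose n j h1 h2 hexc h4
    have hle : 2 ^ j ≤ n := le_trans (Nat.pow_le_pow_right (by norm_num) (by omega)) h1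
    have h3 : n.choose j * 2 ^ (2 ^ j) < 2 ^ n := by
      calc _ < 2 ^ (n - 2 ^ j) * 2 ^ (2 ^ j) := Nat.mul_lt_mul_of_pos_right h (by positivity)
        _ = 2 ^ n := by rw [← pow_add]; congr 1; omega
    have hpos : 1 ≤ n.choose j :=
      Nat.choose_pos (le_trans (Nat.lt_two_pow_self).le hle)
    have h5 : 2 ≤ 2 ^ (2 ^ j) := by
      calc 2 = 2 ^ 1 := by norm_num
        _ ≤ _ := Nat.pow_le_pow_right (by norm_num) (Nat.one_le_two_pow)
    rw [Nat.mul_sub]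
    have h6 : n.choose j * 2 ≤ n.choose j * 2 ^ (2 ^ j) := Nat.mul_le_mul_left _ h5
    omega

theorem card_nonconst {α : Type*} [Fintype α] [DecidableEq α] [Nonempty α] :
    (({fun _ => true, fun _ => false} : Finset (α → Bool))ᶜ).card = 2 ^ Fintype.card α - 2 := by
  rw [Finset.card_compl, Finset.card_pair]
  · simp
  · intro h
    have := congrFun h (Classical.arbitrary α)
    simp at this

theorem IsRBSep.mono {V : Type*} {G : SimpleGraph V} {c : V → Bool} {S T : Set V}
    (h : IsRBSep G c S) (hST : S ⊆ T) : IsRBSep G c T := by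
  intro r b hr hb he
  apply h r b hr hb
  have := congrArg (· ∩ S) he
  simpa [Set.inter_assoc, Set.inter_eq_self_of_subset_right hST] using this

open Classical in
/-- The trace of a closed neighbourhood on `S`. -/
noncomputable def nbTrace {V : Type*} (G : SimpleGraph V) (S : Finset V) (v : V) : S.powerset :=
  ⟨S.filter (fun u => u ∈ closedNbhd G v), by simp⟩

theorem nbTrace_eq {V : Type*} {G : SimpleGraph V} {S : Finset V} {u v : V}
    (h : nbTrace G S u = nbTrace G S v) : closedNbhd G u ∩ S = closedNbhd G v ∩ S := by
  have h' := congrArg Subtype.val h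
  ext x
  have := Finset.ext_iff.1 h' x
  simp only [nbTrace, Finset.mem_filter] at this
  simp only [Set.mem_inter_iff, Finset.mem_coe]
  tauto

theorem factor {V : Type*} {G : SimpleGraph V} {c : V → Bool} {S : Finset V}
    (h : IsRBSep G c S) : ∃ f : S.powerset → Bool, c = fun v => f (nbTrace G S v) := by
  have hf : Function.FactorsThrough c (nbTrace G S) := by
    intro u v huv
    have he := nbTrace_eq huv
    cases hu : c u <;> cases hv : c v
    · rfl
    · exact (h v u hv hu he.symm).elim
    · exact (h u v hu hv he).elim
    · rfl
  exact ⟨Function.extend (nbTrace G S) c (fun _ => true), by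
    funext v; exact (hf.extend_apply _ v).symm⟩

theorem exists_sep_card {V : Type*} [Fintype V] (G : SimpleGraph V) (htwin : TwinFree G)
    (c : V → Bool) (j : ℕ) (hj : sepRB G c ≤ j) (hjn : j ≤ Fintype.card V) :
    ∃ S : Finset V, S.card = j ∧ IsRBSep G c S := by
  have hne : {m | ∃ S : Finset V, S.card = m ∧ IsRBSep G c ↑S}.Nonempty := by
    refine ⟨_, Finset.univ, rfl, ?_⟩
    intro r b hr hb
    simp only [Finset.coe_univ, Set.inter_univ]
    apply htwin
    rintro rfl
    simp [hr] at hb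
  obtain ⟨S, hS, hsep⟩ := Nat.sInf_mem hne
  change S.card = sepRB G c at hS
  obtain ⟨T, hST, hT⟩ := Finset.exists_superset_card_eq (s := S) (n := j) (by omega) hjn
  exact ⟨T, hT, hsep.mono (by exact_mod_cast hST)⟩

theorem stmt2 {V : Type*} [Fintype V] (G : SimpleGraph V) (htwin : TwinFree G)
    (hn : 1 ≤ Fintype.card V)
    (hexc : Fintype.card V ∉ ({8, 9, 16, 17} : Set ℕ)) :
    Nat.log 2 (Fintype.card V) ≤ maxsepRB G := by
  classical
  rcases hk : Nat.log 2 (Fintype.card V) with _ | j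
  · exact Nat.zero_le _
  have h1 : 2 ^ (j + 1) ≤ Fintype.card V := by
    rw [← hk]; exact Nat.pow_log_le_self 2 (by omega)
  have h2 : Fintype.card V < 2 ^ (j + 2) := by
    have := Nat.lt_pow_succ_log_self (b := 2) (by norm_num) (Fintype.card V)
    rwa [hk] at this
  have har := arith_main _ j h1 h2 hexc
  have hjn : j ≤ Fintype.card V :=
    le_trans (le_trans (by omega) (Nat.lt_two_pow_self (n := j + 1)).le) h1
  by_contra hlt
  have hall : ∀ c : V → Bool, sepRB G c ≤ j := by
    intro c
    have : sepRB G c ≤ maxsepRB G :=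
      le_csSup (Set.finite_range _).bddAbove ⟨c, rfl⟩
    omega
  have hV : Nonempty V := Fintype.card_pos_iff.1 (by omega)
  have hsub : ({fun _ => true, fun _ => false} : Finset (V → Bool))ᶜ ⊆
      (Finset.powersetCard j (Finset.univ : Finset V)).biUnion (fun S =>
        (({fun _ => true, fun _ => false} : Finset (S.powerset → Bool))ᶜ).image
          (fun f v => f (nbTrace G S v))) := by
    intro c hc
    obtain ⟨S, hS, hsep⟩ := exists_sep_card G htwin c j (hall c) hjn
    obtain ⟨f, hf⟩ := factor hsep
    rw [Finset.mem_biUnion]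
    refine ⟨S, by simp [Finset.mem_powersetCard, hS], ?_⟩
    rw [Finset.mem_image]
    refine ⟨f, ?_, hf.symm⟩
    rw [Finset.mem_compl, Finset.mem_insert, Finset.mem_singleton] at hc ⊢
    rintro (rfl | rfl)
    · exact hc (Or.inl hf)
    · exact hc (Or.inr hf)
  have hcard := (Finset.card_le_card hsub).trans
    (Finset.card_biUnion_le_card_mul _ _ (2 ^ (2 ^ j) - 2) (by
      intro S hS
      refine Finset.card_image_le.trans ?_
      have : Nonempty S.powerset := ⟨⟨∅, by simp⟩⟩
      rw [card_nonconst, Fintype.card_coe, Finset.card_powerset,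
        (Finset.mem_powersetCard.1 hS).2]))
  rw [card_nonconst, Finset.card_powersetCard, Finset.card_univ] at hcard
  omega
end

section
/- Let G be a twin-free graph of order n and let k = maxsepRB(G). Then 2^n ≤ C(n,k)·2^(2^k), where C(n,k) is the binomial coefficient; in particular 2^n ≤ n^k · 2^(2^k). -/
theorem isRBSep_exists_card {V : Type*} [Fintype V] (G : SimpleGraph V) (htwin : TwinFree G)
    (c : V → Bool) : ∃ S : Finset V, S.card = maxsepRB G ∧ IsRBSep G c ↑S := by
  classical
  have hne : {m | ∃ S : Finset V, S.card = m ∧ IsRBSep G c ↑S}.Nonempty := by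
    refine ⟨_, Finset.univ, rfl, ?_⟩
    intro r b hr hb
    simp only [Finset.coe_univ, Set.inter_univ]
    apply htwin
    rintro rfl
    simp [hr] at hb
  obtain ⟨S, hS, hsep⟩ := Nat.sInf_mem hne
  have h1 : S.card ≤ maxsepRB G := by
    rw [hS]
    exact le_csSup (Set.finite_range _).bddAbove ⟨c, rfl⟩
  have h2 : maxsepRB G ≤ Fintype.card V := by
    apply csSup_le (Set.range_nonempty _)
    rintro _ ⟨d, rfl⟩
    refine Nat.sInf_le ⟨Finset.univ, rfl, ?_⟩
    intro r b hr hb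
    simp only [Finset.coe_univ, Set.inter_univ]
    apply htwin
    rintro rfl
    simp [hr] at hb
  obtain ⟨T, hST, hT⟩ := Finset.exists_superset_card_eq h1 h2
  refine ⟨T, hT, ?_⟩
  intro r b hr hb h
  apply hsep r b hr hb
  have hi : (T : Set V) ∩ S = S := Set.inter_eq_right.mpr (by exact_mod_cast hST)
  rw [← hi, ← Set.inter_assoc, ← Set.inter_assoc, h]

theorem two_pow_le_choose {V : Type*} [Fintype V] (G : SimpleGraph V) (htwin : TwinFree G) :
    2 ^ Fintype.card V ≤
      (Fintype.card V).choose (maxsepRB G) * 2 ^ (2 ^ maxsepRB G) := by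
  classical
  let tr : Finset V → V → Finset V := fun S v => S.filter (fun u => u ∈ closedNbhd G v)
  have htr : ∀ S v w, tr S v = tr S w → closedNbhd G v ∩ S = closedNbhd G w ∩ S := by
    intro S v w h
    ext u
    have := Finset.ext_iff.mp h u
    simp only [tr, Finset.mem_filter] at this
    simp only [Set.mem_inter_iff, Finset.mem_coe]
    tauto
  let F : Finset V → Finset (V → Bool) := fun S =>
    S.powerset.powerset.image (fun A v => decide (tr S v ∈ A))
  have hcov : (Finset.univ : Finset (V → Bool)) ⊆
      (Finset.powersetCard (maxsepRB G) Finset.univ).biUnion F := by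
    intro c _
    obtain ⟨S, hS, hsep⟩ := isRBSep_exists_card G htwin c
    simp only [Finset.mem_biUnion, Finset.mem_powersetCard, F, Finset.mem_image,
      Finset.mem_powerset]
    refine ⟨S, ⟨Finset.subset_univ _, hS⟩,
      (Finset.univ.filter (fun v => c v = true)).image (tr S), ?_, ?_⟩
    · intro T hT
      obtain ⟨v, _, rfl⟩ := Finset.mem_image.mp hT
      exact Finset.mem_powerset.mpr (Finset.filter_subset _ _)
    · funext v
      cases hv : c v
      · simp only [decide_eq_false_iff_not, Finset.mem_image, Finset.mem_filter,
          Finset.mem_univ, true_and]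
        rintro ⟨r, hr, h⟩
        exact hsep r v hr hv (htr _ _ _ h)
      · simp only [decide_eq_true_eq, Finset.mem_image, Finset.mem_filter,
          Finset.mem_univ, true_and]
        exact ⟨v, hv, rfl⟩
  have h1 := Finset.card_le_card hcov
  have h2 := Finset.card_biUnion_le_card_mul (Finset.powersetCard (maxsepRB G) Finset.univ) F
    (2 ^ (2 ^ maxsepRB G)) (by
      intro S hS
      refine Finset.card_image_le.trans ?_
      rw [Finset.card_powerset, Finset.card_powerset, (Finset.mem_powersetCard.mp hS).2])
  have h3 := h1.trans h2
  simpa [Finset.card_powersetCard] using h3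

theorem stmt3 {V : Type*} [Fintype V] (G : SimpleGraph V) (htwin : TwinFree G) :
    2 ^ Fintype.card V ≤
      (Fintype.card V).choose (maxsepRB G) * 2 ^ (2 ^ maxsepRB G) ∧
    2 ^ Fintype.card V ≤
      Fintype.card V ^ maxsepRB G * 2 ^ (2 ^ maxsepRB G) := by
  have h := two_pow_le_choose G htwin
  exact ⟨h, h.trans (Nat.mul_le_mul_right _ (Nat.choose_le_pow _ _))⟩
end

section
/- For any integer k ≥ 1, there exists a twin-free graph G of order n = 2^k with maxsepRB(G) = k. -/
/-- Witness graph on subsets of `Fin k`: large sets form a clique, singletons are joined to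
the large sets containing them. -/
def wit (k : ℕ) : SimpleGraph (Finset (Fin k)) where
  Adj A B := A ≠ B ∧ ((2 ≤ A.card ∧ 2 ≤ B.card) ∨ (A.card = 1 ∧ 2 ≤ B.card ∧ A ⊆ B) ∨
    (B.card = 1 ∧ 2 ≤ A.card ∧ B ⊆ A))
  symm := ⟨by rintro A B ⟨h, h'⟩; exact ⟨h.symm, by tauto⟩⟩
  loopless := ⟨by rintro A ⟨h, -⟩; exact h rfl⟩

theorem wit_single (k : ℕ) (A : Finset (Fin k)) (i : Fin k) :
    ((wit k).Adj A {i} ∨ {i} = A) ↔ i ∈ A := by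
  simp only [wit, Finset.card_singleton, Finset.singleton_subset_iff]
  constructor
  · rintro (⟨h, h' | h' | h'⟩ | h)
    · omega
    · omega
    · exact h'.2.2
    · simp [← h]
  · intro h
    by_cases hA : {i} = A
    · exact Or.inr hA
    · refine Or.inl ⟨fun h => hA h.symm, Or.inr (Or.inr ⟨trivial, ?_, h⟩)⟩
      by_contra hc
      apply hA
      apply Finset.eq_of_subset_of_card_le
      · simpa using h
      · simp; omega

theorem wit_univ (k : ℕ) (hk : 2 ≤ k) (i : Fin k) (B : Finset (Fin k)) (hB : B ≠ {i}) :
    ((wit k).Adj Finset.univ B ∨ B = Finset.univ) ↔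
      ((wit k).Adj (Finset.univ.erase i) B ∨ B = Finset.univ.erase i) := by
  have hc : (Finset.univ.erase i : Finset (Fin k)).card = k - 1 := by
    simp [Finset.card_erase_of_mem]
  have hu : (Finset.univ : Finset (Fin k)).card = k := by simp
  have hne : (Finset.univ : Finset (Fin k)) ≠ Finset.univ.erase i := by
    intro h; rw [← h] at hc; omega
  rcases Nat.lt_or_ge B.card 2 with h2 | h2
  · rcases Nat.lt_or_ge B.card 1 with h1 | h1
    · have hb : B.card = 0 := by omega
      have e1 : B ≠ Finset.univ := by rintro rfl; omega
      have e2 : B ≠ Finset.univ.erase i := by rintro rfl; omega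
      simp [wit, hb, e1, e2]
    · have hb : B.card = 1 := by omega
      obtain ⟨j, rfl⟩ := Finset.card_eq_one.1 hb
      rw [wit_single, wit_single]
      have : j ≠ i := by rintro rfl; exact hB rfl
      simp [this]
  · have lhs : ((wit k).Adj Finset.univ B ∨ B = Finset.univ) := by
      by_cases h : B = Finset.univ
      · exact Or.inr h
      · exact Or.inl ⟨fun h' => h h'.symm, Or.inl ⟨by omega, h2⟩⟩
    refine iff_of_true lhs ?_
    by_cases h : B = Finset.univ.erase i
    · exact Or.inr h
    refine Or.inl ⟨fun h' => h h'.symm, ?_⟩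
    by_cases h3 : 3 ≤ k
    · exact Or.inl ⟨by omega, h2⟩
    · refine Or.inr (Or.inl ⟨by omega, h2, ?_⟩)
      have : B = Finset.univ := by
        apply Finset.eq_of_subset_of_card_le (Finset.subset_univ _)
        omega
      rw [this]; exact Finset.subset_univ _

theorem stmt5 (k : ℕ) (hk : 1 ≤ k) :
    ∃ G : SimpleGraph (Fin (2 ^ k)), TwinFree G ∧ maxsepRB G = k := by
  classical
  have e : Fin (2 ^ k) ≃ Finset (Fin k) := (Fintype.equivFinOfCardEq (by simp)).symm
  let G := (wit k).comap e
  have mem : ∀ u v, u ∈ closedNbhd G v ↔ ((wit k).Adj (e v) (e u) ∨ e u = e v) := by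
    intro u v
    simp [closedNbhd, G]
  have inj : Function.Injective (fun i : Fin k => e.symm {i}) := by
    intro i j h
    simpa using h
  let S : Finset (Fin (2 ^ k)) := Finset.univ.image (fun i : Fin k => e.symm {i})
  have hS : S.card = k := by
    simp [S, Finset.card_image_of_injective _ inj]
  have sep : IsSep G (S : Set _) := by
    intro u v huv h
    apply huv
    apply e.injective
    ext i
    have hi : e.symm {i} ∈ (S : Set _) := by simp [S]
    have := Set.ext_iff.1 h (e.symm {i})
    simp only [Set.mem_inter_iff, hi, and_true, mem, Equiv.apply_symm_apply, wit_single] at this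
    exact this
  have rb : ∀ c, IsRBSep G c (S : Set _) := by
    intro c r b hr hb
    apply sep
    rintro rfl
    simp [hr] at hb
  have ub : ∀ c, sepRB G c ≤ k := fun c => Nat.sInf_le ⟨S, hS, rb c⟩
  refine ⟨G, ?_, ?_⟩
  · intro u v huv h
    exact sep u v huv (by rw [h])
  · apply le_antisymm
    · apply csSup_le (Set.range_nonempty _)
      rintro _ ⟨c, rfl⟩
      exact ub c
    · let c : Fin (2 ^ k) → Bool := fun v => decide (e v = Finset.univ)
      refine le_trans ?_ (le_csSup ⟨k, ?_⟩ ⟨c, rfl⟩)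
      · refine le_csInf ⟨k, S, hS, rb c⟩ ?_
        rintro m ⟨T, rfl, hT⟩
        have hne : ∀ i : Fin k, (Finset.univ.erase i : Finset (Fin k)) ≠ Finset.univ := by
          intro i h
          have : i ∈ (Finset.univ.erase i : Finset (Fin k)) := by rw [h]; simp
          simp at this
        have key : ∀ i : Fin k, _ := fun i => hT (e.symm Finset.univ)
          (e.symm (Finset.univ.erase i)) (by simp [c])
          (by simp only [c, Equiv.apply_symm_apply]; exact decide_eq_false (hne i))
        rcases Nat.lt_or_ge k 2 with h2 | h2
        · have : T.Nonempty := by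
            rw [Finset.nonempty_iff_ne_empty]
            rintro rfl
            exact key ⟨0, hk⟩ (by simp)
          have := this.card_pos
          omega
        · refine hS.symm.le.trans ?_
          apply Finset.card_le_card
          intro x hx
          obtain ⟨i, -, rfl⟩ := Finset.mem_image.1 hx
          by_contra hi
          apply key i
          ext x
          simp only [Set.mem_inter_iff, mem, Equiv.apply_symm_apply]
          refine and_congr_left fun hxT => ?_
          apply wit_univ k h2
          intro h
          apply hi
          rw [← h]
          simpa using hxT
      · rintro _ ⟨c, rfl⟩
        exact ub c
end

section
/- Let G be a twin-free graph on n vertices. Then sep(G) ≤ ⌈log₂(n)⌉ · maxsepRB(G). -/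
theorem stmt6 {V : Type*} [Fintype V] (G : SimpleGraph V) (htwin : TwinFree G) :
    sepNum G ≤ Nat.clog 2 (Fintype.card V) * maxsepRB G := by
  classical
  have hRB : ∀ c : V → Bool, ∃ S : Finset V, S.card ≤ maxsepRB G ∧ IsRBSep G c ↑S := by
    intro c
    have hne : {m | ∃ S : Finset V, S.card = m ∧ IsRBSep G c ↑S}.Nonempty := by
      refine ⟨_, Finset.univ, rfl, ?_⟩
      intro r b hr hb h
      simp only [Finset.coe_univ, Set.inter_univ] at h
      refine htwin r b ?_ h
      rintro rfl
      simp [hr] at hb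
    obtain ⟨S, hS, hsep⟩ := Nat.sInf_mem hne
    refine ⟨S, ?_, hsep⟩
    rw [hS]
    exact le_csSup (Set.finite_range fun c : V → Bool => sepRB G c).bddAbove ⟨c, rfl⟩
  let e := Fintype.equivFin V
  choose S hcard hsep using fun i : ℕ => hRB (fun v => (e v : ℕ).testBit i)
  let T := (Finset.range (Nat.clog 2 (Fintype.card V))).biUnion S
  have hT : IsSep G ↑T := by
    intro u v huv h
    apply huv
    apply e.injective
    apply Fin.ext
    apply Nat.eq_of_testBit_eq
    intro i
    by_cases hi : i < Nat.clog 2 (Fintype.card V)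
    · have hsub : (↑(S i) : Set V) ⊆ ↑T := by
        intro x hx
        exact Finset.mem_biUnion.2 ⟨i, Finset.mem_range.2 hi, hx⟩
      have h' : closedNbhd G u ∩ ↑(S i) = closedNbhd G v ∩ ↑(S i) := by
        rw [← Set.inter_eq_self_of_subset_right hsub, ← Set.inter_assoc, h, Set.inter_assoc]
      have h1 := hsep i u v
      have h2 := hsep i v u
      cases hu : (e u : ℕ).testBit i <;> cases hv : (e v : ℕ).testBit i
      · rfl
      · exact absurd h'.symm (h2 hv hu)
      · exact absurd h' (h1 hu hv)
      · rfl
    · have hb : ∀ w : V, (e w : ℕ).testBit i = false := by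
        intro w
        apply Nat.testBit_lt_two_pow
        calc (e w : ℕ) < Fintype.card V := (e w).2
          _ ≤ 2 ^ Nat.clog 2 (Fintype.card V) := Nat.le_pow_clog (by norm_num) _
          _ ≤ 2 ^ i := Nat.pow_le_pow_right (by norm_num) (by omega)
      rw [hb, hb]
  calc sepNum G ≤ T.card := Nat.sInf_le ⟨T, rfl, hT⟩
    _ ≤ (Finset.range (Nat.clog 2 (Fintype.card V))).card * maxsepRB G :=
        Finset.card_biUnion_le_card_mul _ _ _ fun i _ => hcard i
    _ = _ := by rw [Finset.card_range]
end

section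
/- Let G be a twin-free graph on n vertices with maximum degree Δ(G) and domination number γ(G). Then sep(G) ≤ ⌈log₂(Δ(G)+1)⌉ · maxsepRB(G) + γ(G). -/
/-- The domination number of a graph: the minimum size of a dominating set. -/
noncomputable def domNum {V : Type*} [Fintype V] (G : SimpleGraph V) : ℕ :=
  sInf {m | ∃ D : Finset V, D.card = m ∧ ∀ v : V, ∃ d ∈ D, d ∈ closedNbhd G v}

theorem exists_rbsep_le {V : Type*} [Fintype V] (G : SimpleGraph V)
    (htwin : TwinFree G) (c : V → Bool) :
    ∃ S : Finset V, S.card ≤ maxsepRB G ∧ IsRBSep G c ↑S := by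
  have hne : {m | ∃ S : Finset V, S.card = m ∧ IsRBSep G c ↑S}.Nonempty := by
    refine ⟨_, Finset.univ, rfl, ?_⟩
    intro r b hr hb h
    simp only [Finset.coe_univ, Set.inter_univ] at h
    refine htwin r b ?_ h
    rintro rfl
    simp [hr] at hb
  obtain ⟨S, hS, hsep⟩ := Nat.sInf_mem hne
  refine ⟨S, ?_, hsep⟩
  rw [hS]
  exact le_csSup (Set.finite_range _).bddAbove ⟨c, rfl⟩

theorem stmt7 {V : Type*} [Fintype V] (G : SimpleGraph V) [DecidableRel G.Adj]
    (htwin : TwinFree G) :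
    sepNum G ≤ Nat.clog 2 (G.maxDegree + 1) * maxsepRB G + domNum G := by
  classical
  have hne : {m | ∃ D : Finset V, D.card = m ∧ ∀ v : V, ∃ d ∈ D, d ∈ closedNbhd G v}.Nonempty :=
    ⟨_, Finset.univ, rfl, fun v => ⟨v, Finset.mem_univ _, Or.inr rfl⟩⟩
  obtain ⟨D, hD, hdom⟩ := Nat.sInf_mem hne
  set k := Nat.clog 2 (G.maxDegree + 1) with hk
  have hpow : G.maxDegree + 1 ≤ 2 ^ k := Nat.le_pow_clog (by norm_num) _
  have hlab : ∀ T : Set V, ∃ g : V → ℕ, (∀ u, closedNbhd G u ∩ ↑D = T → g u < 2 ^ k) ∧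
      ∀ u v, closedNbhd G u ∩ ↑D = T → closedNbhd G v ∩ ↑D = T → g u = g v → u = v := by
    intro T
    set C : Finset V := Finset.univ.filter (fun u => closedNbhd G u ∩ ↑D = T) with hC
    have hcard : C.card ≤ 2 ^ k := by
      rcases C.eq_empty_or_nonempty with h | ⟨w, hw⟩
      · simp [h]
      · have hw' : closedNbhd G w ∩ ↑D = T := by simpa [hC] using hw
        obtain ⟨d, hdD, hdw⟩ := hdom w
        have hdT : d ∈ T := hw' ▸ ⟨hdw, hdD⟩
        have hsub : C ⊆ insert d (G.neighborFinset d) := by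
          intro u hu
          have hu' : closedNbhd G u ∩ ↑D = T := by simpa [hC] using hu
          have h1 : d ∈ closedNbhd G u ∩ ↑D := hu' ▸ hdT
          rcases h1.1 with h | h
          · simp [h.symm]
          · simp [h]
        calc C.card ≤ _ := Finset.card_le_card hsub
          _ ≤ (G.neighborFinset d).card + 1 := Finset.card_insert_le _ _
          _ ≤ G.maxDegree + 1 := by
            rw [G.card_neighborFinset_eq_degree]
            exact Nat.succ_le_succ (G.degree_le_maxDegree d)
          _ ≤ _ := hpow
    have hmem : ∀ u, closedNbhd G u ∩ ↑D = T → u ∈ C := fun u hu => by simp [hC, hu]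
    refine ⟨fun u => if h : u ∈ C then (C.equivFin ⟨u, h⟩ : ℕ) else 0, ?_, ?_⟩
    · intro u hu
      simp only [hmem u hu, dif_pos]
      exact lt_of_lt_of_le (Fin.is_lt _) hcard
    · intro u v hu hv h
      simp only [hmem u hu, hmem v hv, dif_pos] at h
      have h2 := C.equivFin.injective (Fin.ext h)
      exact congrArg Subtype.val h2
  choose g hg1 hg2 using hlab
  let c : ℕ → V → Bool := fun i u => (g (closedNbhd G u ∩ ↑D) u).testBit i
  choose S hScard hS using fun i => exists_rbsep_le G htwin (c i)
  set U : Finset V := (Finset.range k).biUnion S ∪ D with hU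
  have hUcard : U.card ≤ k * maxsepRB G + domNum G := by
    refine (Finset.card_union_le _ _).trans (add_le_add ?_ hD.le)
    have := Finset.card_biUnion_le_card_mul (Finset.range k) S (maxsepRB G) (fun i _ => hScard i)
    simpa using this
  refine le_trans (Nat.sInf_le ⟨U, rfl, ?_⟩) hUcard
  intro u v huv h
  have hrestr : ∀ A : Finset V, A ⊆ U → closedNbhd G u ∩ ↑A = closedNbhd G v ∩ ↑A := by
    intro A hA
    ext x
    have hx := Set.ext_iff.mp h x
    simp only [Set.mem_inter_iff, Finset.mem_coe] at hx ⊢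
    have := @hA x
    tauto
  have hDe := hrestr D Finset.subset_union_right
  apply huv
  refine hg2 _ u v rfl hDe.symm (Nat.eq_of_testBit_eq fun i => ?_)
  by_cases hi : i < k
  · have hSe := hrestr (S i) ((Finset.subset_biUnion_of_mem S (Finset.mem_range.mpr hi)).trans
      Finset.subset_union_left)
    have hcv : c i v = (g (closedNbhd G u ∩ ↑D) v).testBit i := by simp only [c, hDe]
    rw [← hcv]
    change c i u = c i v
    cases h1 : c i u <;> cases h2 : c i v
    · rfl
    · exact absurd hSe.symm (hS i v u h2 h1)
    · exact absurd hSe (hS i u v h1 h2)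
    · rfl
  · have hp : 2 ^ k ≤ 2 ^ i := Nat.pow_le_pow_right (by norm_num) (not_lt.mp hi)
    rw [Nat.testBit_lt_two_pow ((hg1 _ u rfl).trans_le hp),
      Nat.testBit_lt_two_pow ((hg1 _ v hDe.symm).trans_le hp)]
end

section
/- Let G = K_{k₁,…,k_t} be a complete t-partite graph of order n with t ≥ 2 parts, where every part size k_i ≥ 5 is odd. Then sep(G) = n − t. -/
theorem stmt8 (t : ℕ) (ht : 2 ≤ t) (k : Fin t → ℕ)
    (hk : ∀ i, 5 ≤ k i) (hodd : ∀ i, Odd (k i)) :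
    sepNum (SimpleGraph.completeMultipartiteGraph fun i : Fin t => Fin (k i)) =
      (∑ i, k i) - t := by
  classical
  have hcard : Fintype.card (Σ i : Fin t, Fin (k i)) = ∑ i, k i := by simp
  unfold sepNum
  apply le_antisymm
  · apply Nat.sInf_le
    let f : Fin t → (Σ i : Fin t, Fin (k i)) := fun i => ⟨i, ⟨0, by have := hk i; omega⟩⟩
    have hf : Function.Injective f := fun i j h => congrArg Sigma.fst h
    refine ⟨(Finset.univ.image f)ᶜ, ?_, ?_⟩
    · rw [Finset.card_compl, Finset.card_image_of_injective _ hf, hcard]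
      simp
    · have key : ∀ x : (Σ i : Fin t, Fin (k i)), x.2.val ≠ 0 →
          x ∈ ((((Finset.univ.image f)ᶜ : Finset _)) : Set (Σ i : Fin t, Fin (k i))) := by
        intro x hx
        simp only [Finset.coe_compl, Set.mem_compl_iff, Finset.mem_coe, Finset.mem_image,
          Finset.mem_univ, true_and, not_exists]
        rintro i rfl
        exact hx rfl
      generalize ((((Finset.univ.image f)ᶜ : Finset _)) : Set (Σ i : Fin t, Fin (k i))) = S at key
      rintro ⟨i, a⟩ ⟨j, b⟩ hne heq
      rw [Set.ext_iff] at heq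
      by_cases hij : i = j
      · subst hij
        have hab : a ≠ b := fun h => hne (by rw [h])
        by_cases ha : a.val = 0
        · have hb : b.val ≠ 0 := fun h => hab (Fin.ext (by omega))
          have := (heq ⟨i, b⟩).2 ⟨Or.inr rfl, key _ hb⟩
          rcases this.1 with h | h
          · exact h rfl
          · exact hne h.symm
        · have := (heq ⟨i, a⟩).1 ⟨Or.inr rfl, key _ ha⟩
          rcases this.1 with h | h
          · exact h rfl
          · exact hne h
      · obtain ⟨w, hw0, hwa⟩ : ∃ w : Fin (k i), w.val ≠ 0 ∧ w ≠ a := by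
          have := hk i
          by_cases h : a.val = 1
          · exact ⟨⟨2, by omega⟩, by simp, fun e => by rw [← e] at h; simp at h⟩
          · exact ⟨⟨1, by omega⟩, by simp, fun e => by rw [← e] at h; simp at h⟩
        have := (heq ⟨i, w⟩).2 ⟨Or.inl (fun h => hij h.symm), key _ hw0⟩
        rcases this.1 with h | h
        · exact h rfl
        · simp only [Sigma.mk.injEq, heq_eq_eq, true_and] at h
          exact hwa h
  · apply le_csInf
    · refine ⟨_, Finset.univ, rfl, ?_⟩
      rintro ⟨i, a⟩ ⟨j, b⟩ hne heq
      simp only [Finset.coe_univ, Set.inter_univ, Set.ext_iff] at heq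
      by_cases hij : i = j
      · subst hij
        rcases (heq ⟨i, a⟩).1 (Or.inr rfl) with h | h
        · exact h rfl
        · exact hne h
      · obtain ⟨w, hwa⟩ : ∃ w : Fin (k i), w ≠ a := by
          have := hk i
          by_cases h : a.val = 1
          · exact ⟨⟨2, by omega⟩, fun e => by rw [← e] at h; simp at h⟩
          · exact ⟨⟨1, by omega⟩, fun e => by rw [← e] at h; simp at h⟩
        rcases (heq ⟨i, w⟩).2 (Or.inl (fun h => hij h.symm)) with h | h
        · exact h rfl
        · simp only [Sigma.mk.injEq, heq_eq_eq, true_and] at h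
          exact hwa h
    · rintro m ⟨S, rfl, hS⟩
      have h1 : Sᶜ.card ≤ (Finset.univ : Finset (Fin t)).card := by
        apply Finset.card_le_card_of_injOn Sigma.fst (fun _ _ => Finset.mem_coe.2 (Finset.mem_univ _))
        rintro ⟨i, a⟩ ha ⟨j, b⟩ hb hij
        simp only [Finset.coe_compl, Set.mem_compl_iff, Finset.mem_coe] at ha hb hij
        subst hij
        by_contra hne
        apply hS _ _ hne
        ext x
        constructor
        · rintro ⟨h | h, hx⟩
          · exact ⟨Or.inl h, hx⟩
          · exact absurd (h ▸ hx) ha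
        · rintro ⟨h | h, hx⟩
          · exact ⟨Or.inl h, hx⟩
          · exact absurd (h ▸ hx) hb
      rw [Finset.card_compl, hcard, Finset.card_univ, Fintype.card_fin] at h1
      omega
end

section
/- Let G = K_{k₁,…,k_t} be a complete t-partite graph of order n with t ≥ 2 parts, where every part size k_i ≥ 5 is odd. Then maxsepRB(G) = (n − t)/2. -/
lemma stmt9_upper (t : ℕ) (m : Fin t → ℕ) (hm : ∀ i, 2 ≤ m i)
    (c : (Σ i : Fin t, Fin (2 * m i + 1)) → Bool) :
    ∃ S : Finset (Σ i : Fin t, Fin (2 * m i + 1)), S.card = ∑ i, m i ∧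
      IsRBSep (SimpleGraph.completeMultipartiteGraph fun i : Fin t => Fin (2 * m i + 1)) c ↑S := by
  have hT : ∀ i, ∃ T : Finset (Fin (2 * m i + 1)), T.card = m i ∧
      ((∀ x, c ⟨i, x⟩ = true → x ∈ T) ∨ (∀ x, c ⟨i, x⟩ = false → x ∈ T)) := by
    intro i
    have h := Finset.card_filter_add_card_filter_not (s := (Finset.univ : Finset (Fin (2 * m i + 1))))
      (fun x => c ⟨i, x⟩ = true)
    rw [Finset.card_univ, Fintype.card_fin] at h
    by_cases h1 : (Finset.univ.filter fun x : Fin (2 * m i + 1) => c ⟨i, x⟩ = true).card ≤ m i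
    · obtain ⟨T, hT, hc⟩ := Finset.exists_superset_card_eq h1 (by simp; omega)
      exact ⟨T, hc, Or.inl fun x hx => hT (by simp [hx])⟩
    · have h2 : (Finset.univ.filter fun x : Fin (2 * m i + 1) => ¬ c ⟨i, x⟩ = true).card ≤ m i := by
        omega
      obtain ⟨T, hT, hc⟩ := Finset.exists_superset_card_eq h2 (by simp; omega)
      exact ⟨T, hc, Or.inr fun x hx => hT (by simp [hx])⟩
  choose T hTc hT using hT
  refine ⟨Finset.univ.sigma T, by simp [Finset.card_sigma, hTc], ?_⟩
  rintro ⟨i, x⟩ ⟨j, y⟩ hr hb heq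
  by_cases hij : i = j
  · subst hij
    have hxy : x ≠ y := by
      rintro rfl
      simp [hr] at hb
    rcases hT i with h | h
    · have hx := h x hr
      have := Set.ext_iff.1 heq ⟨i, x⟩
      simp [closedNbhd, hx, hxy] at this
    · have hy := h y hb
      have := Set.ext_iff.1 heq ⟨i, y⟩
      simp [closedNbhd, hy, hxy.symm] at this
  · obtain ⟨z, hz, hzx⟩ := Finset.exists_mem_ne (s := T i) (by have := hm i; have := hTc i; omega) x
    have := Set.ext_iff.1 heq ⟨i, z⟩
    simp [closedNbhd, hz, hzx, Ne.symm hij] at this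

lemma stmt9_lower (t : ℕ) (m : Fin t → ℕ)
    (S : Finset (Σ i : Fin t, Fin (2 * m i + 1)))
    (hS : IsRBSep (SimpleGraph.completeMultipartiteGraph fun i : Fin t => Fin (2 * m i + 1))
      (fun v => decide (v.2.val < m v.1)) ↑S) :
    ∑ i, m i ≤ S.card := by
  classical
  let T : ∀ i : Fin t, Finset (Fin (2 * m i + 1)) := fun i => Finset.univ.filter fun x => ⟨i, x⟩ ∈ S
  have hST : S = Finset.univ.sigma T := by
    ext ⟨i, x⟩
    simp [T]
  rw [hST, Finset.card_sigma]
  refine Finset.sum_le_sum fun i _ => ?_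
  by_cases h : ∀ x : Fin (2 * m i + 1), x.val < m i → x ∈ T i
  · calc m i = (Finset.univ : Finset (Fin (m i))).card := by simp
      _ ≤ (T i).card := Finset.card_le_card_of_injOn
        (fun x => (⟨x.val, by omega⟩ : Fin (2 * m i + 1)))
        (fun x _ => h _ x.2) (fun a _ b _ hab => by simpa [Fin.ext_iff] using hab)
  · push Not at h
    obtain ⟨x, hx, hxT⟩ := h
    have h : ∀ y : Fin (2 * m i + 1), m i ≤ y.val → y ∈ T i := by
      intro y hy
      by_contra hyT
      refine hS ⟨i, x⟩ ⟨i, y⟩ (by simpa using hx) (by simpa using hy) ?_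
      simp only [T, Finset.mem_filter, Finset.mem_univ, true_and] at hxT hyT
      ext ⟨j, z⟩
      simp only [closedNbhd, Set.mem_inter_iff, Set.mem_setOf_eq, Finset.mem_coe]
      refine and_congr_left fun hz => ?_
      have h1 : (⟨j, z⟩ : Σ i : Fin t, Fin (2 * m i + 1)) ≠ ⟨i, x⟩ := fun e => hxT (e ▸ hz)
      have h2 : (⟨j, z⟩ : Σ i : Fin t, Fin (2 * m i + 1)) ≠ ⟨i, y⟩ := fun e => hyT (e ▸ hz)
      simp only [h1, h2, or_false]
      simp
    calc m i = (Finset.univ : Finset (Fin (m i))).card := by simp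
      _ ≤ (T i).card := Finset.card_le_card_of_injOn
        (fun x => (⟨m i + x.val, by omega⟩ : Fin (2 * m i + 1)))
        (fun x _ => h _ (by simp)) (fun a _ b _ hab => by simpa [Fin.ext_iff] using hab)

theorem stmt9 (t : ℕ) (ht : 2 ≤ t) (k : Fin t → ℕ)
    (hk : ∀ i, 5 ≤ k i) (hodd : ∀ i, Odd (k i)) :
    maxsepRB (SimpleGraph.completeMultipartiteGraph fun i : Fin t => Fin (k i)) =
      ((∑ i, k i) - t) / 2 := by
  choose m hm using hodd
  obtain rfl : k = fun i => 2 * m i + 1 := funext hm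
  have hm2 : ∀ i, 2 ≤ m i := fun i => by have := hk i; dsimp only at this; omega
  have hsum : ((∑ i, (2 * m i + 1)) - t) / 2 = ∑ i, m i := by
    rw [Finset.sum_add_distrib, ← Finset.mul_sum]
    simp
  have hle : ∀ c, sepRB (SimpleGraph.completeMultipartiteGraph
      fun i : Fin t => Fin (2 * m i + 1)) c ≤ ∑ i, m i :=
    fun c => Nat.sInf_le (stmt9_upper t m hm2 c)
  refine Eq.trans ?_ hsum.symm
  apply le_antisymm
  · refine csSup_le (Set.range_nonempty _) ?_
    rintro _ ⟨c, rfl⟩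
    exact hle c
  · refine le_csSup_of_le ⟨∑ i, m i, ?_⟩ ⟨fun v => decide (v.2.val < m v.1), rfl⟩ ?_
    · rintro _ ⟨c, rfl⟩
      exact hle c
    · refine le_csInf ⟨_, stmt9_upper t m hm2 _⟩ ?_
      rintro _ ⟨S, rfl, hS⟩
      exact stmt9_lower t m S hS
end

section
/- (Bondy's Theorem) Let V be an n-element set and let A₁, A₂, …, Aₙ be n pairwise distinct subsets of V. Then there exists an (n−1)-element subset X of V such that the sets A₁ ∩ X, A₂ ∩ X, …, Aₙ ∩ X are still pairwise distinct. -/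
theorem bondy_aux {V : Type*} [DecidableEq V] (F : Finset (Finset V)) :
    ∃ X : Finset V, X.card ≤ F.card - 1 ∧
      ∀ S ∈ F, ∀ T ∈ F, S ∩ X = T ∩ X → S = T := by
  induction F using Finset.induction_on with
  | empty => exact ⟨∅, by simp, by simp⟩
  | insert S F hS ih =>
    obtain ⟨X, hX, hinj⟩ := ih
    rw [Finset.card_insert_of_notMem hS]
    by_cases h : ∃ T ∈ F, T ∩ X = S ∩ X
    · obtain ⟨T, hT, hTS⟩ := h
      have hne : T ≠ S := fun h => hS (h ▸ hT)
      obtain ⟨v, hv⟩ : ∃ v, ¬ (v ∈ T ↔ v ∈ S) := by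
        by_contra hcon
        push Not at hcon
        exact hne (Finset.ext hcon)
      have hpos : 0 < F.card := Finset.card_pos.2 ⟨T, hT⟩
      have hc := Finset.card_insert_le v X
      have key : ∀ P Q : Finset V, P ∩ insert v X = Q ∩ insert v X →
          P ∩ X = Q ∩ X ∧ (v ∈ P ↔ v ∈ Q) := by
        intro P Q h
        rw [Finset.ext_iff] at h
        refine ⟨?_, by simpa using h v⟩
        ext a
        have := h a
        simp only [Finset.mem_inter, Finset.mem_insert] at this ⊢
        tauto
      have key2 : ∀ P ∈ F, P ∩ insert v X ≠ S ∩ insert v X := by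
        intro P hP h
        obtain ⟨h1, h2⟩ := key _ _ h
        have : P = T := hinj P hP T hT (h1.trans hTS.symm)
        subst this
        exact hv h2
      refine ⟨insert v X, by omega, ?_⟩
      intro P hP Q hQ hPQ
      rcases Finset.mem_insert.1 hP with rfl | hP1 <;>
        rcases Finset.mem_insert.1 hQ with rfl | hQ1
      · rfl
      · exact absurd hPQ.symm (key2 Q hQ1)
      · exact absurd hPQ (key2 P hP1)
      · exact hinj P hP1 Q hQ1 (key _ _ hPQ).1
    · push Not at h
      refine ⟨X, by omega, ?_⟩
      intro P hP Q hQ hPQ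
      rcases Finset.mem_insert.1 hP with rfl | hP1 <;>
        rcases Finset.mem_insert.1 hQ with rfl | hQ1
      · rfl
      · exact absurd hPQ.symm (h Q hQ1)
      · exact absurd hPQ (h P hP1)
      · exact hinj P hP1 Q hQ1 hPQ

theorem stmt10 {V : Type*} [Fintype V] [DecidableEq V]
    (A : Fin (Fintype.card V) → Finset V) (hA : Function.Injective A) :
    ∃ X : Finset V, X.card = Fintype.card V - 1 ∧
      Function.Injective (fun i => A i ∩ X) := by
  obtain ⟨X, hX, hinj⟩ := bondy_aux (Finset.univ.image A)
  rw [Finset.card_image_of_injective _ hA, Finset.card_univ, Fintype.card_fin] at hX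
  obtain ⟨Y, hXY, -, hY⟩ := Finset.exists_subsuperset_card_eq (Finset.subset_univ X) hX
    (by rw [Finset.card_univ]; omega)
  refine ⟨Y, hY, fun i j hij => hA (hinj _ (by simp) _ (by simp) ?_)⟩
  have h2 : (A i ∩ Y) ∩ X = (A j ∩ Y) ∩ X := congrArg (· ∩ X) hij
  rwa [Finset.inter_assoc, Finset.inter_assoc, Finset.inter_eq_right.2 hXY] at h2
end

section
/- For every integer k ≥ 1, the complement of the half-graph satisfies maxsepRB(complement of H_k) = 2k − 1. -/
/-- The half-graph `H_k`: a bipartite graph on two copies of `Fin k`, with `v_i` (left)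
adjacent to `w_j` (right) if and only if `i ≤ j`. -/
def halfGraph (k : ℕ) : SimpleGraph (Fin k ⊕ Fin k) :=
  SimpleGraph.fromRel fun a b =>
    ∃ i j : Fin k, a = Sum.inl i ∧ b = Sum.inr j ∧ i ≤ j

theorem aux_ll (k : ℕ) (i a : Fin k) : Sum.inl a ∈ closedNbhd (halfGraph k)ᶜ (Sum.inl i) := by
  simp only [closedNbhd, halfGraph, Set.mem_ofPred_eq, SimpleGraph.compl_adj, SimpleGraph.fromRel_adj]
  by_cases h : a = i <;> simp [h]
  exact fun h' => h h'.symm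

theorem aux_rr (k : ℕ) (i a : Fin k) : Sum.inr a ∈ closedNbhd (halfGraph k)ᶜ (Sum.inr i) := by
  simp only [closedNbhd, halfGraph, Set.mem_ofPred_eq, SimpleGraph.compl_adj, SimpleGraph.fromRel_adj]
  by_cases h : a = i <;> simp [h]
  exact fun h' => h h'.symm

theorem aux_lr (k : ℕ) (i b : Fin k) :
    Sum.inr b ∈ closedNbhd (halfGraph k)ᶜ (Sum.inl i) ↔ b < i := by
  simp [closedNbhd, halfGraph]

theorem aux_rl (k : ℕ) (j a : Fin k) :
    Sum.inl a ∈ closedNbhd (halfGraph k)ᶜ (Sum.inr j) ↔ j < a := by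
  simp [closedNbhd, halfGraph]

theorem aux_mem (k : ℕ) (hk : 1 ≤ k) (c : Fin k ⊕ Fin k → Bool) :
    2 * k - 1 ∈ {m | ∃ S : Finset (Fin k ⊕ Fin k), S.card = m ∧ IsRBSep (halfGraph k)ᶜ c ↑S} := by
  refine ⟨Finset.univ.erase (Sum.inl ⟨0, hk⟩), ?_, ?_⟩
  · rw [Finset.card_erase_of_mem (Finset.mem_univ _)]
    simp [two_mul]
  · intro r b hr hb h
    have hne : r ≠ b := by rintro rfl; simp_all
    have key : ∀ x, x ≠ Sum.inl ⟨0, hk⟩ → (x ∈ closedNbhd (halfGraph k)ᶜ r ↔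
        x ∈ closedNbhd (halfGraph k)ᶜ b) := by
      intro x hx
      have := Set.ext_iff.1 h x
      simpa [hx] using this
    have kr := fun j : Fin k => key (Sum.inr j) (by simp)
    have kl := fun (j : Fin k) (hj : (j : ℕ) ≠ 0) => key (Sum.inl j)
      (by simp [Fin.ext_iff, hj])
    rcases r with r | r <;> rcases b with b | b
    · simp only [aux_lr, Fin.lt_def] at kr
      have := kr r
      have := kr b
      apply hne
      congr 1
      ext
      omega
    · have := kr ⟨k - 1, by omega⟩
      simp only [aux_lr, aux_rr, Fin.lt_def, iff_true, true_iff] at this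
      have := r.2
      omega
    · have := kr ⟨k - 1, by omega⟩
      simp only [aux_lr, aux_rr, Fin.lt_def, iff_true, true_iff] at this
      have := b.2
      omega
    · simp only [aux_rl, Fin.lt_def] at kl
      have h1 := kl r
      have h2 := kl b
      apply hne
      congr 1
      ext
      by_cases hr0 : (r : ℕ) = 0 <;> by_cases hb0 : (b : ℕ) = 0
      · omega
      · have := h2 hb0; omega
      · have := h1 hr0; omega
      · have := h1 hr0; have := h2 hb0; omega

/-- The extremal coloring: alternating on both cliques. -/
def auxCol (k : ℕ) : Fin k ⊕ Fin k → Bool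
  | Sum.inl i => decide ((i + k - 1 : ℕ) % 2 = 0)
  | Sum.inr j => decide ((j : ℕ) % 2 = 1)

theorem aux_sep {V : Type*} {G : SimpleGraph V} {c : V → Bool} {S : Set V} (h : IsRBSep G c S)
    {u v : V} (huv : c u ≠ c v) :
    ∃ x ∈ S, ¬ (x ∈ closedNbhd G u ↔ x ∈ closedNbhd G v) := by
  by_contra hcon
  push Not at hcon
  have e : closedNbhd G u ∩ S = closedNbhd G v ∩ S := by
    ext x
    constructor
    · rintro ⟨h1, h2⟩
      exact ⟨(hcon x h2).1 h1, h2⟩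
    · rintro ⟨h1, h2⟩
      exact ⟨(hcon x h2).2 h1, h2⟩
  cases hu : c u <;> cases hv : c v
  · simp_all
  · exact h v u hv hu e.symm
  · exact h u v hu hv e
  · simp_all

theorem aux_lower (k : ℕ) (hk : 1 ≤ k) (S : Finset (Fin k ⊕ Fin k))
    (h : IsRBSep (halfGraph k)ᶜ (auxCol k) ↑S) : 2 * k - 1 ≤ S.card := by
  have hr : ∀ j : Fin k, (j : ℕ) + 1 < k → Sum.inr j ∈ S := by
    intro j hj
    obtain ⟨x, hx, hn⟩ := aux_sep h (u := Sum.inl j) (v := Sum.inl ⟨j + 1, hj⟩)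
      (by simp only [auxCol, ne_eq, decide_eq_decide]; omega)
    rcases x with x | x
    · simp [aux_ll] at hn
    · simp only [aux_lr, Fin.lt_def] at hn
      have : x = j := by ext; omega
      rw [← this]; exact hx
  have hl : ∀ j : Fin k, (j : ℕ) ≠ 0 → Sum.inl j ∈ S := by
    intro j hj
    obtain ⟨x, hx, hn⟩ := aux_sep h (u := Sum.inr ⟨j - 1, by omega⟩) (v := Sum.inr j)
      (by simp only [auxCol, ne_eq, decide_eq_decide]; omega)
    rcases x with x | x
    · simp only [aux_rl, Fin.lt_def] at hn
      have : x = j := by ext; omega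
      rw [← this]; exact hx
    · simp [aux_rr] at hn
  have card : ∀ y, Finset.univ.erase y ⊆ S → 2 * k - 1 ≤ S.card := by
    intro y hy
    have := Finset.card_le_card hy
    rw [Finset.card_erase_of_mem (Finset.mem_univ _)] at this
    simpa [two_mul] using this
  obtain ⟨x, hx, hn⟩ := aux_sep h (u := Sum.inl ⟨k - 1, by omega⟩) (v := Sum.inr ⟨0, hk⟩)
      (by simp only [auxCol, ne_eq, decide_eq_decide]; omega)
  rcases x with x | x
  · simp only [aux_ll, aux_rl, Fin.lt_def] at hn
    apply card (Sum.inr ⟨k - 1, by omega⟩)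
    intro z hz
    rcases z with z | z
    · by_cases hz0 : (z : ℕ) = 0
      · have : z = x := by ext; simp at hn; omega
        rw [this]; exact hx
      · exact hl z hz0
    · simp [Fin.ext_iff] at hz
      exact hr z (by omega)
  · simp only [aux_rr, aux_lr, Fin.lt_def] at hn
    apply card (Sum.inl ⟨0, hk⟩)
    intro z hz
    rcases z with z | z
    · simp [Fin.ext_iff] at hz
      exact hl z hz
    · by_cases hz0 : (z : ℕ) + 1 < k
      · exact hr z hz0
      · have : z = x := by ext; simp at hn; omega
        rw [this]; exact hx

theorem stmt12 (k : ℕ) (hk : 1 ≤ k) :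
    maxsepRB (halfGraph k)ᶜ = 2 * k - 1 := by
  apply IsGreatest.csSup_eq
  constructor
  · refine ⟨auxCol k, le_antisymm (Nat.sInf_le (aux_mem k hk _)) ?_⟩
    apply le_csInf
    · exact ⟨_, aux_mem k hk _⟩
    · rintro m ⟨S, rfl, hS⟩
      exact aux_lower k hk S hS
  · rintro _ ⟨c, rfl⟩
    exact Nat.sInf_le (aux_mem k hk c)
end

section
/- Let T be a tree on n ≥ 3 vertices and let c be a red-blue coloring of T with exactly one red vertex. Then sepRB(T,c) ≤ 2. -/
lemma stmt13_no_common {V : Type*} (T : SimpleGraph V) (hT : T.IsAcyclic) {r b u w : V}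
    (hru : T.Adj r u) (hrw : T.Adj r w) (huw : u ≠ w) (hbu : T.Adj b u ∨ u = b)
    (hbw : T.Adj b w ∨ w = b) : r = b := by
  by_contra hne
  let p : T.Walk u w := .cons hru.symm (.cons hrw .nil)
  have hp : p.IsPath := by
    simp [p, SimpleGraph.Walk.cons_isPath_iff, hru.ne', hrw.ne, huw]
  have key : ∀ q : T.Walk u w, q.IsPath → p.support = q.support := by
    intro q hq
    have := hT.path_unique ⟨p, hp⟩ ⟨q, hq⟩
    rw [Subtype.mk.injEq] at this
    rw [this]
  have tri : ¬ T.Adj u w := by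
    intro h
    have := key (.cons h .nil) (by simp [SimpleGraph.Walk.cons_isPath_iff, huw])
    simp [p] at this
  rcases hbu with hbu | rfl
  · rcases hbw with hbw | rfl
    · have := key (.cons hbu.symm (.cons hbw .nil))
        (by simp [SimpleGraph.Walk.cons_isPath_iff, hbu.ne', hbw.ne, huw])
      simp [p] at this
      exact hne this
    · exact tri hbu.symm
  · rcases hbw with hbw | h
    · exact tri hbw
    · exact huw h.symm

theorem stmt13 {V : Type*} [Fintype V] (T : SimpleGraph V) (hT : T.IsTree)
    (hn : 3 ≤ Fintype.card V) (c : V → Bool)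
    (hone : (Finset.univ.filter fun v => c v = true).card = 1) :
    sepRB T c ≤ 2 := by
  classical
  obtain ⟨r, hr⟩ := Finset.card_eq_one.mp hone
  have hred : ∀ v, c v = true ↔ v = r := by
    intro v
    have := Finset.ext_iff.mp hr v
    simpa using this
  suffices h : ∃ x y : V, x ≠ y ∧ ∀ b, b ≠ r →
      ¬ ((x ∈ closedNbhd T r ↔ x ∈ closedNbhd T b) ∧
        (y ∈ closedNbhd T r ↔ y ∈ closedNbhd T b)) by
    obtain ⟨x, y, hxy, h⟩ := h
    refine Nat.sInf_le ⟨{x, y}, Finset.card_pair hxy, ?_⟩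
    intro r' b hr' hb heq
    obtain rfl := (hred r').mp hr'
    refine h b ?_ ⟨?_, ?_⟩
    · rintro rfl; simp [hr'] at hb
    · simpa using Set.ext_iff.mp heq x
    · simpa using Set.ext_iff.mp heq y
  have bd : ∀ S : Finset V, r ∈ S → S.card < 3 → ∃ a ∈ S, ∃ z, z ∉ S ∧ T.Adj a z := by
    intro S hS hc
    obtain ⟨z, hz⟩ : ∃ z, z ∉ S := by
      by_contra! hall
      have : S = Finset.univ := by ext; simp [hall]
      rw [this, Finset.card_univ] at hc
      omega
    obtain ⟨p⟩ := hT.connected.preconnected r z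
    obtain ⟨d, -, h1, h2⟩ := p.exists_boundary_dart (S : Set V) (by simpa using hS) (by simpa using hz)
    exact ⟨d.fst, by simpa using h1, d.snd, by simpa using h2, d.adj⟩
  obtain ⟨a, ha, u, hu, hau⟩ := bd {r} (by simp) (by simp)
  simp only [Finset.mem_singleton] at ha hu
  subst ha
  by_cases hw : ∃ w, T.Adj a w ∧ u ≠ w
  · obtain ⟨w, haw, huw⟩ := hw
    refine ⟨u, w, huw, fun b hb ⟨h1, h2⟩ => hb ?_⟩
    exact (stmt13_no_common T hT.isAcyclic hau haw huw (h1.mp (Or.inl hau))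
      (h2.mp (Or.inl haw))).symm
  · push Not at hw
    obtain ⟨d, hd, x, hx, hdx⟩ := bd {a, u} (by simp)
      (lt_of_le_of_lt Finset.card_le_two (by norm_num))
    simp only [Finset.mem_insert, Finset.mem_singleton, not_or] at hd hx
    rcases hd with rfl | rfl
    · exact absurd (hw x hdx).symm hx.2
    refine ⟨a, x, Ne.symm hx.1, fun b hb ⟨h1, h2⟩ => ?_⟩
    rcases h1.mp (Or.inr rfl) with h | h
    · obtain rfl := hw b h.symm
      rcases h2.mpr (Or.inl hdx) with h' | h'
      · exact hx.2 (hw x h').symm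
      · exact hx.1 h'
    · exact hb h.symm
end

section
/- For any tree T of order n ≥ 5, maxsepRB(T) ≤ (n + s(T))/2, where s(T) is the number of support vertices of T. -/
/-- A vertex is a leaf if it has exactly one neighbor. -/
def IsLeafVertex {V : Type*} (G : SimpleGraph V) (u : V) : Prop :=
  ∃! w, G.Adj u w

/-- The set of support vertices: vertices adjacent to at least one leaf. -/
def supports {V : Type*} (G : SimpleGraph V) : Set V :=
  {v | ∃ u, G.Adj v u ∧ IsLeafVertex G u}

section
open Classical

lemma rb_closed_all {V : Type*} {T : SimpleGraph V} (hT : T.IsTree) (P : V → Prop) (x : V) (hx : P x)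
    (h : ∀ u v, P u → T.Adj u v → P v) (v : V) : P v := by
  obtain ⟨w⟩ := hT.1 x v
  induction w with
  | nil => exact hx
  | cons a _ ih => exact ih (h _ _ hx a)

lemma rb_bip {V : Type*} {T : SimpleGraph V} (hT : T.IsTree) :
    ∃ p : V → Bool, ∀ u v, T.Adj u v → p u ≠ p v := by
  obtain ⟨C⟩ := hT.isAcyclic.isBipartite
  refine ⟨fun v => decide (C v = 0), fun u v h => ?_⟩
  have := C.valid h
  simp only [ne_eq, decide_eq_decide]
  omega

lemma rb_no4 {V : Type*} {T : SimpleGraph V} (hT : T.IsTree) {u v a b : V} (huv : u ≠ v)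
    (hua : T.Adj u a) (hva : T.Adj v a) (hub : T.Adj u b) (hvb : T.Adj v b) : a = b := by
  have hp : (SimpleGraph.Walk.cons hua (SimpleGraph.Walk.cons hva.symm .nil)).IsPath := by
    simp [hua.ne, hva.ne', huv]
  have hq : (SimpleGraph.Walk.cons hub (SimpleGraph.Walk.cons hvb.symm .nil)).IsPath := by
    simp [hub.ne, hvb.ne', huv]
  have := (hT.isAcyclic.subsingleton_path u v).elim ⟨_, hp⟩ ⟨_, hq⟩
  simp only [Subtype.mk.injEq, SimpleGraph.Walk.cons.injEq] at this
  exact this.1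


lemma rb_bool {a b c : Bool} (h1 : a ≠ b) (h2 : a ≠ c) : b = c := by
  revert h1 h2
  cases a <;> cases b <;> cases c <;> simp

def rbMixed {V : Type*} (L : V → Prop) (sup : V → V) (c : V → Bool) (x : V) : Prop :=
  (∃ y, L y ∧ sup y = x ∧ c y = c x) ∧ (∃ y, L y ∧ sup y = x ∧ c y ≠ c x)

lemma rb_sep {V : Type*} {T : SimpleGraph V} (hT : T.IsTree) (p c : V → Bool)
    (hp : ∀ u v, T.Adj u v → p u ≠ p v) (L : V → Prop) (sup : V → V) (i : Bool) (C : V → Prop)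
    (hs1 : ∀ y, L y → T.Adj y (sup y)) (hs2 : ∀ y, L y → ∀ w, T.Adj y w → w = sup y)
    (hns : ∀ y, L y → ¬ L (sup y))
    (F1 : ∀ v, ¬ L v → p v = i → C v)
    (F2 : ∀ v, ¬ L v → p v ≠ i → ∃ w1 w2, w1 ≠ w2 ∧ T.Adj v w1 ∧ T.Adj v w2 ∧ C w1 ∧ C w2)
    (F3 : ∀ y, L y → p (sup y) = i → ¬ rbMixed L sup c (sup y) →
      ∃ w, ¬ L w ∧ T.Adj (sup y) w ∧ C w)
    (F5 : ∀ y, L y → p (sup y) = i → (C y ↔ (rbMixed L sup c (sup y) ∧ c y = c (sup y))))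
    (F6 : ∀ y, L y → p (sup y) ≠ i → (C y ↔ ¬ (rbMixed L sup c (sup y) ∧ c y = c (sup y))))
    (F7 : ∀ y, L y → rbMixed L sup c (sup y) → C (sup y))
    (u v : V) (huv : c u ≠ c v)
    (h : ∀ w, C w → ((T.Adj u w ∨ w = u) ↔ (T.Adj v w ∨ w = v))) : False := by
  have hsp : ∀ y, L y → p y ≠ p (sup y) := fun y hy => hp _ _ (hs1 y hy)
  -- leaf versus non-leaf
  have key1 : ∀ y v, L y → ¬ L v → c y ≠ c v →
      (∀ w, C w → ((T.Adj y w ∨ w = y) ↔ (T.Adj v w ∨ w = v))) → False := by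
    intro y v hy hv hc h
    have hsy := hsp y hy
    by_cases hvi : p v = i
    · by_cases hyi : p y = i
      · rcases (h v (F1 v hv hvi)).2 (Or.inr rfl) with h1 | h1
        · exact hp _ _ h1 (hyi.trans hvi.symm)
        · exact hv (h1 ▸ hy)
      · have hxi : p (sup y) = i := rb_bool hsy hyi
        rcases (h (sup y) (F1 _ (hns y hy) hxi)).1 (Or.inl (hs1 y hy)) with h1 | h1
        · exact hp _ _ h1 (hvi.trans hxi.symm)
        · by_cases hm : rbMixed L sup c (sup y)
          · obtain ⟨⟨z, hz, hzx, hzc⟩, -⟩ := id hm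
            have hCz : C z := (F5 z hz (by rw [hzx]; exact hxi)).2 (by rw [hzx]; exact ⟨hm, hzc⟩)
            rcases (h z hCz).2 (Or.inl (by rw [← h1, ← hzx]; exact (hs1 z hz).symm)) with h2 | h2
            · exact hns y hy (hs2 y hy z h2 ▸ hz)
            · subst h2
              rw [h1] at hzc
              exact hc hzc
          · obtain ⟨w, hw, hxw, hCw⟩ := F3 y hy hxi hm
            rcases (h w hCw).2 (Or.inl (h1 ▸ hxw)) with h2 | h2
            · exact hxw.ne (hs2 y hy w h2).symm
            · exact hw (h2 ▸ hy)
    · obtain ⟨w1, w2, hne, a1, a2, C1, C2⟩ := F2 v hv hvi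
      have b1 := (h w1 C1).2 (Or.inl a1)
      have b2 := (h w2 C2).2 (Or.inl a2)
      have q1 := hp _ _ a1
      have q2 := hp _ _ a2
      have e1 : w1 = sup y ∨ w1 = y := b1.imp_left (hs2 y hy w1)
      have e2 : w2 = sup y ∨ w2 = y := b2.imp_left (hs2 y hy w2)
      have e3 : p w1 = p w2 := rb_bool q1 q2
      rcases e1 with rfl | rfl <;> rcases e2 with rfl | rfl
      · exact hne rfl
      · exact hsy e3.symm
      · exact hsy e3
      · exact hne rfl
  by_cases hu : L u
  · by_cases hv : L v
    · have su := hsp u hu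
      have sv := hsp v hv
      have nu := hns u hu
      have nv := hns v hv
      -- a leaf in `C` cannot be shared
      have nCu : ¬ C u := by
        intro hC
        rcases (h u hC).1 (Or.inr rfl) with h1 | h1
        · exact nv (hs2 v hv u h1 ▸ hu)
        · exact huv (h1 ▸ rfl)
      have nCv : ¬ C v := by
        intro hC
        rcases (h v hC).2 (Or.inr rfl) with h1 | h1
        · exact nu (hs2 u hu v h1 ▸ hv)
        · exact huv (h1 ▸ rfl)
      have cu : C (sup u) → sup u = sup v := by
        intro hC
        rcases (h _ hC).1 (Or.inl (hs1 u hu)) with h1 | h1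
        · exact hs2 v hv _ h1
        · exact absurd (h1 ▸ hv) nu
      have cv : C (sup v) → sup u = sup v := by
        intro hC
        rcases (h _ hC).2 (Or.inl (hs1 v hv)) with h1 | h1
        · exact (hs2 u hu _ h1).symm
        · exact absurd (h1 ▸ hu) nv
      have G1 := F1 _ nu
      have G2 := F1 _ nv
      have G3 := F5 u hu
      have G4 := F5 v hv
      have G5 := F6 u hu
      have G6 := F6 v hv
      have G7 := F7 u hu
      have hE : sup u = sup v := by
        by_cases hi : p (sup u) = i
        · exact cu (G1 hi)
        · have hm : rbMixed L sup c (sup u) := by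
            by_contra hm
            exact nCu ((G5 hi).2 (fun hh => hm hh.1))
          exact cu (G7 hm)
      have hmm : ¬ rbMixed L sup c (sup u) → c u = c v := by
        intro hm
        unfold rbMixed at hm
        by_contra hcc
        apply hm
        by_cases hq : c u = c (sup u)
        · exact ⟨⟨u, hu, rfl, hq⟩, ⟨v, hv, hE.symm, fun hh => hcc (hq.trans hh.symm)⟩⟩
        · refine ⟨⟨v, hv, hE.symm, ?_⟩, ⟨u, hu, rfl, hq⟩⟩
          revert hq hcc
          cases c u <;> cases c v <;> cases c (sup u) <;> simp
      rw [← hE] at G4 G6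
      have hm : rbMixed L sup c (sup u) := by
        by_contra hm
        exact huv (hmm hm)
      by_cases hi : p (sup u) = i
      · have a1 : c u ≠ c (sup u) := fun e => nCu ((G3 hi).2 ⟨hm, e⟩)
        have a2 : c v ≠ c (sup u) := fun e => nCv ((G4 hi).2 ⟨hm, e⟩)
        exact huv (rb_bool a1.symm a2.symm)
      · have a1 : c u = c (sup u) := by
          by_contra e
          exact nCu ((G5 hi).2 (fun hh => e hh.2))
        have a2 : c v = c (sup u) := by
          by_contra e
          exact nCv ((G6 hi).2 (fun hh => e hh.2))
        exact huv (a1.trans a2.symm)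
    · exact key1 u v hu hv huv h
  · by_cases hv : L v
    · exact key1 v u hv hu huv.symm (fun w hw => (h w hw).symm)
    · have key2 : ∀ u v, ¬ L u → ¬ L v → u ≠ v → p u = i →
        (∀ w, C w → ((T.Adj u w ∨ w = u) ↔ (T.Adj v w ∨ w = v))) → False := by
        intro u v hu hv hne hi h
        have h1 := (h u (F1 u hu hi)).1 (Or.inr rfl)
        have h2 : T.Adj v u := h1.resolve_right hne
        have h3 := hp _ _ h2
        obtain ⟨w1, w2, hw, a1, a2, C1, C2⟩ := F2 v hv (fun e => h3 (e.trans hi.symm))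
        have b1 := (h w1 C1).2 (Or.inl a1)
        have b2 := (h w2 C2).2 (Or.inl a2)
        have q1 := hp _ _ a1
        have q2 := hp _ _ a2
        have r1 := hp u w1
        have r2 := hp u w2
        have s1 : p u = p w1 := rb_bool h3 q1
        have s2 : p u = p w2 := rb_bool h3 q2
        exact hw ((b1.resolve_left (fun e => r1 e s1)).trans (b2.resolve_left (fun e => r2 e s2)).symm)
      have hne : u ≠ v := fun e => huv (e ▸ rfl)
      by_cases hui : p u = i
      · exact key2 u v hu hv hne hui h
      · by_cases hvi : p v = i
        · exact key2 v u hv hu hne.symm hvi (fun w hw => (h w hw).symm)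
        · obtain ⟨w1, w2, hw, a1, a2, C1, C2⟩ := F2 u hu hui
          have b1 := (h w1 C1).1 (Or.inl a1)
          have b2 := (h w2 C2).1 (Or.inl a2)
          have q1 := hp _ _ a1
          have q2 := hp _ _ a2
          have n1 : w1 ≠ v := fun e => q1 (rb_bool (Ne.symm hui) (e ▸ Ne.symm hvi))
          have n2 : w2 ≠ v := fun e => q2 (rb_bool (Ne.symm hui) (e ▸ Ne.symm hvi))
          exact hw (rb_no4 hT hne a1 (b1.resolve_right n1) a2 (b2.resolve_right n2))

lemma rb_star {V : Type*} [Fintype V] {T : SimpleGraph V} (c : V → Bool) (x : V)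
    (hx : ∀ y, y ≠ x → T.Adj x y) (hy : ∀ y w, y ≠ x → T.Adj y w → w = x)
    (hn : 5 ≤ Fintype.card V) :
    ∃ S : Finset V, IsRBSep T c ↑S ∧ 2 * S.card ≤ Fintype.card V + 1 := by
  obtain ⟨k, hk⟩ : ∃ k : Bool,
      2 * ((Finset.univ.erase x).filter (fun y => c y = k)).card ≤ Fintype.card V - 1 := by
    have h1 := Finset.card_filter_add_card_filter_not (s := Finset.univ.erase x)
      (fun y => c y = true)
    rw [Finset.card_erase_of_mem (Finset.mem_univ x), Finset.card_univ] at h1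
    simp only [Bool.not_eq_true] at h1
    by_cases h : 2 * ((Finset.univ.erase x).filter (fun y => c y = true)).card ≤ Fintype.card V - 1
    · exact ⟨true, h⟩
    · exact ⟨false, by omega⟩
  obtain ⟨S, hS1, hS2, hS3⟩ := Finset.exists_subsuperset_card_eq
    (s := (Finset.univ.erase x).filter (fun y => c y = k)) (t := Finset.univ.erase x)
    (n := max ((Finset.univ.erase x).filter (fun y => c y = k)).card 2)
    (Finset.filter_subset _ _) (le_max_left _ _) (by
      rw [Finset.card_erase_of_mem (Finset.mem_univ x), Finset.card_univ]; omega)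
  refine ⟨S, ?_, by omega⟩
  have hxS : x ∉ S := fun h => by simpa using hS2 h
  have hM : ∀ y, y ≠ x → c y = k → y ∈ S := fun y h1 h2 => hS1 (by simp [h1, h2])
  obtain ⟨a, ha, b, hb, hab⟩ := Finset.one_lt_card.1 (show 1 < S.card by omega)
  have hax : a ≠ x := fun e => hxS (e ▸ ha)
  have hbx : b ≠ x := fun e => hxS (e ▸ hb)
  have main : ∀ u v, c u ≠ c v → u ≠ x → c u = k ∨ v = x →
      (∀ w, w ∈ S → ((T.Adj u w ∨ w = u) ↔ (T.Adj v w ∨ w = v))) → False := by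
    intro u v huv hu hor h
    by_cases hv : v = x
    · subst hv
      have h1 := (h a ha).2 (Or.inl (hx a hax))
      have h2 := (h b hb).2 (Or.inl (hx b hbx))
      have h3 := h1.resolve_left (fun e => hax (hy u a hu e))
      have h4 := h2.resolve_left (fun e => hbx (hy u b hu e))
      exact hab (h3.trans h4.symm)
    · have h1 := (h u (hM u hu (hor.resolve_right hv))).1 (Or.inr rfl)
      rcases h1 with h1 | h1
      · exact hu (hy v u hv h1)
      · exact huv (h1 ▸ rfl)
  intro r b hr hb he
  have he' : ∀ w, w ∈ S → ((T.Adj r w ∨ w = r) ↔ (T.Adj b w ∨ w = b)) := by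
    intro w hw
    have := Set.ext_iff.1 he w
    simpa [closedNbhd, hw] using this
  by_cases h1 : r = x
  · exact main b r (by simp [hr, hb]) (fun e => by subst e; subst h1; simp_all) (Or.inr h1)
      (fun w hw => (he' w hw).symm)
  · by_cases h2 : b = x
    · exact main r b (by simp [hr, hb]) h1 (Or.inr h2) he'
    · cases k
      · exact main b r (by simp [hr, hb]) h2 (Or.inl hb) (fun w hw => (he' w hw).symm)
      · exact main r b (by simp [hr, hb]) h1 (Or.inl hr) he'

lemma rb_nonstar {V : Type*} [Fintype V] {T : SimpleGraph V} (hT : T.IsTree)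
    (hn : 5 ≤ Fintype.card V) (c : V → Bool)
    (hb : ∀ x ∈ supports T, ∃ b, T.Adj x b ∧ ¬ IsLeafVertex T b) :
    ∃ S : Finset V, IsRBSep T c ↑S ∧ 2 * S.card ≤ Fintype.card V + (supports T).ncard := by
  obtain ⟨p, hp⟩ := rb_bip hT
  obtain ⟨sup, hsup⟩ : ∃ sup : V → V, ∀ y, IsLeafVertex T y →
      T.Adj y (sup y) ∧ ∀ w, T.Adj y w → w = sup y := by
    have : ∀ y, ∃ x, IsLeafVertex T y → T.Adj y x ∧ ∀ w, T.Adj y w → w = x := by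
      intro y
      by_cases hy : IsLeafVertex T y
      · obtain ⟨x, h1, h2⟩ := hy
        exact ⟨x, fun _ => ⟨h1, h2⟩⟩
      · exact ⟨y, fun h => absurd h hy⟩
    choose f hf using this
    exact ⟨f, hf⟩
  obtain ⟨β, hβ⟩ : ∃ β : V → V, ∀ x ∈ supports T, T.Adj x (β x) ∧ ¬ IsLeafVertex T (β x) := by
    have : ∀ x, ∃ b, x ∈ supports T → T.Adj x b ∧ ¬ IsLeafVertex T b := by
      intro x
      by_cases hx : x ∈ supports T
      · obtain ⟨b, h⟩ := hb x hx
        exact ⟨b, fun _ => h⟩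
      · exact ⟨x, fun h => absurd h hx⟩
    choose f hf using this
    exact ⟨f, hf⟩
  have hs1 : ∀ y, IsLeafVertex T y → T.Adj y (sup y) := fun y hy => (hsup y hy).1
  have hs2 : ∀ y, IsLeafVertex T y → ∀ w, T.Adj y w → w = sup y := fun y hy => (hsup y hy).2
  have hns : ∀ y, IsLeafVertex T y → ¬ IsLeafVertex T (sup y) := by
    intro y hy hx
    have hall := rb_closed_all hT (fun v => v = y ∨ v = sup y) y (Or.inl rfl) (by
      rintro u v (rfl | rfl) ha
      · exact Or.inr (hs2 _ hy _ ha)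
      · left
        exact (hs2 _ hx v ha).trans (hs2 _ hx y (hs1 y hy).symm).symm)
    have : (Finset.univ : Finset V) ⊆ {y, sup y} := fun v _ => by simpa using hall v
    have h1 := Finset.card_le_card this
    have h2 : ({y, sup y} : Finset V).card ≤ 2 := Finset.card_le_two
    rw [Finset.card_univ] at h1
    omega
  have hmemS : ∀ y, IsLeafVertex T y → sup y ∈ supports T := fun y hy => ⟨y, (hs1 y hy).symm, hy⟩
  have hSL : ∀ x ∈ supports T, ¬ IsLeafVertex T x := by
    rintro x ⟨y, ha, hy⟩
    rw [hs2 y hy x ha.symm]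
    exact hns y hy
  set L := IsLeafVertex T with hL
  set Mx := rbMixed L sup c with hMx
  set tr : V → Prop := fun x => x ∈ supports T ∧ ¬ Mx x ∧ ∀ b, T.Adj x b → b ∉ supports T with htr
  set C : Bool → V → Prop := fun i v =>
    if L v then (p (sup v) = i ↔ (Mx (sup v) ∧ c v = c (sup v)))
    else if v ∈ supports T then (p v = i ∨ ¬ tr v)
    else (p v = i ∨ ∃ x, tr x ∧ β x = v) with hC
  have hsep : ∀ i, IsRBSep T c ↑(Finset.univ.filter (C i)) := by
    intro i r b hr hbb he
    have he' : ∀ w, C i w → ((T.Adj r w ∨ w = r) ↔ (T.Adj b w ∨ w = b)) := by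
      intro w hw
      have := Set.ext_iff.1 he w
      simpa [closedNbhd, hw] using this
    have F1 : ∀ v, ¬ L v → p v = i → C i v := by
      intro v hv hi
      simp only [hC, hv, if_false, hi, true_or, ite_self]
    have F5 : ∀ y, L y → p (sup y) = i → (C i y ↔ (Mx (sup y) ∧ c y = c (sup y))) := by
      intro y hy hi
      simp only [hC, hy, if_true, hi, true_iff]
    have F6 : ∀ y, L y → p (sup y) ≠ i → (C i y ↔ ¬ (Mx (sup y) ∧ c y = c (sup y))) := by
      intro y hy hi
      simp only [hC, hy, if_true, hi, false_iff]
    refine rb_sep hT p c hp L sup i (C i) hs1 hs2 hns F1 ?_ ?_ F5 F6 ?_ r b (by simp [hr, hbb]) he'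
    · intro v hv hi
      by_cases hvs : v ∈ supports T
      · obtain ⟨h1, h2⟩ := hβ v hvs
        obtain ⟨z, hz, hzv, hzC⟩ : ∃ z, L z ∧ sup z = v ∧ C i z := by
          by_cases hm : Mx v
          · obtain ⟨-, z, hz, hzx, hzc⟩ := id hm
            exact ⟨z, hz, hzx, (F6 z hz (hzx ▸ hi)).2 (fun h => hzc (hzx ▸ h.2))⟩
          · obtain ⟨z, ha, hz⟩ := id hvs
            have hzx := (hs2 z hz v ha.symm).symm
            exact ⟨z, hz, hzx, (F6 z hz (hzx ▸ hi)).2 (fun h => hm (hzx ▸ h.1))⟩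
        refine ⟨β v, z, fun e => h2 (e ▸ hz), h1, hzv ▸ (hs1 z hz).symm, ?_, hzC⟩
        exact F1 _ h2 (rb_bool (hp _ _ h1) hi)
      · have hnl : ∀ w, T.Adj v w → ¬ L w := fun w hw hl => hvs ⟨w, hw, hl⟩
        have : Nontrivial V := Fintype.one_lt_card_iff_nontrivial.1 (by omega)
        obtain ⟨w1, hw1⟩ : ∃ w, T.Adj v w := hT.1.preconnected.exists_adj_of_nontrivial v
        obtain ⟨w2, hw2, hne⟩ : ∃ w, T.Adj v w ∧ w ≠ w1 := by
          by_contra hcon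
          push Not at hcon
          exact hv ⟨w1, hw1, hcon⟩
        exact ⟨w1, w2, hne.symm, hw1, hw2, F1 _ (hnl _ hw1) (rb_bool (hp _ _ hw1) hi),
          F1 _ (hnl _ hw2) (rb_bool (hp _ _ hw2) hi)⟩
    · intro y hy hi hm
      have hxs := hmemS y hy
      by_cases hsn : ∃ b, T.Adj (sup y) b ∧ b ∈ supports T
      · obtain ⟨b, h1, h2⟩ := hsn
        refine ⟨b, hSL b h2, h1, ?_⟩
        have : ¬ tr b := fun h => h.2.2 _ h1.symm hxs
        simp only [hC, hSL b h2, h2, if_false, if_true, this, not_false_iff, or_true]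
      · push Not at hsn
        obtain ⟨h1, h2⟩ := hβ _ hxs
        refine ⟨_, h2, h1, ?_⟩
        have h3 : ∃ x, tr x ∧ β x = β (sup y) := ⟨sup y, ⟨hxs, hm, hsn⟩, rfl⟩
        simp only [hC, h2, hsn _ h1, if_false, h3, or_true]
    · intro y hy hm
      have hxs := hmemS y hy
      have : ¬ tr (sup y) := fun h => h.2.1 hm
      simp only [hC, hns y hy, hxs, if_false, if_true, this, not_false_iff, or_true]
  have hcount : (Finset.univ.filter (C true)).card + (Finset.univ.filter (C false)).card
      + (Finset.univ.filter tr).card ≤ Fintype.card V + (Finset.univ.filter (· ∈ supports T)).card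
        + ((Finset.univ.filter tr).image β).card := by
    have e : ((Finset.univ.filter tr).image β).card
        = (Finset.univ.filter (fun v => ∃ x, tr x ∧ β x = v)).card := by
      congr 1
      ext v
      simp
    rw [e, ← Finset.card_univ, Finset.card_eq_sum_ones Finset.univ]
    simp only [Finset.card_filter, ← Finset.sum_add_distrib]
    refine Finset.sum_le_sum fun v _ => ?_
    by_cases hv : L v
    · have h1 : v ∉ supports T := fun h => hSL v h hv
      have h2 : ¬ tr v := fun h => h1 h.1
      simp only [hC, hv, if_true, h1, h2, if_false]
      by_cases hq : Mx (sup v) ∧ c v = c (sup v)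
      · simp only [hq]
        cases p (sup v) <;> simp
      · simp only [hq]
        cases p (sup v) <;> simp
    · by_cases h1 : v ∈ supports T
      · by_cases h2 : tr v
        · simp only [hC, hv, h1, h2, if_true, if_false, not_true, or_false]
          cases p v <;> simp
        · simp only [hC, hv, h1, h2, if_true, if_false, not_false_iff, or_true]
          omega
      · have h2 : ¬ tr v := fun h => h1 h.1
        by_cases h3 : ∃ x, tr x ∧ β x = v
        · simp only [hC, hv, h1, h2, h3, if_true, if_false, or_true]
          omega
        · simp only [hC, hv, h1, h2, h3, if_false, or_false]
          cases p v <;> simp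
  have hi := Finset.card_image_le (s := Finset.univ.filter tr) (f := β)
  have hsc : (supports T).ncard = (Finset.univ.filter (· ∈ supports T)).card := by
    rw [← Set.ncard_coe_finset]
    congr 1
    ext v
    simp
  by_cases hle : (Finset.univ.filter (C true)).card ≤ (Finset.univ.filter (C false)).card
  · exact ⟨_, hsep true, by omega⟩
  · exact ⟨_, hsep false, by omega⟩

lemma rb_main {V : Type*} [Fintype V] {T : SimpleGraph V} (hT : T.IsTree)
    (hn : 5 ≤ Fintype.card V) (c : V → Bool) :
    ∃ S : Finset V, IsRBSep T c ↑S ∧ 2 * S.card ≤ Fintype.card V + (supports T).ncard := by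
  by_cases hb : ∀ x ∈ supports T, ∃ b, T.Adj x b ∧ ¬ IsLeafVertex T b
  · exact rb_nonstar hT hn c hb
  · push Not at hb
    obtain ⟨x, hx, hl⟩ := hb
    have hleaf : ∀ y w, T.Adj x y → T.Adj y w → w = x := by
      intro y w h1 h2
      obtain ⟨z, -, h4⟩ := hl y h1
      rw [h4 w h2, h4 x h1.symm]
    have hall := rb_closed_all hT (fun v => v = x ∨ T.Adj x v) x (Or.inl rfl) (by
      rintro u v (rfl | hu) ha
      · exact Or.inr ha
      · exact Or.inl (hleaf u v hu ha))
    have hadj : ∀ y, y ≠ x → T.Adj x y := fun y hy => (hall y).resolve_left hy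
    obtain ⟨S, h1, h2⟩ := rb_star c x hadj (fun y w hy ha => hleaf y w (hadj y hy) ha) hn
    refine ⟨S, h1, ?_⟩
    have : 0 < (supports T).ncard := (Set.ncard_pos (Set.toFinite _)).2 ⟨x, hx⟩
    omega

end

theorem stmt14 {V : Type*} [Fintype V] (T : SimpleGraph V) (hT : T.IsTree)
    (hn : 5 ≤ Fintype.card V) :
    (maxsepRB T : ℝ) ≤ (Fintype.card V + (supports T).ncard) / 2 := by
  classical
  suffices h : 2 * maxsepRB T ≤ Fintype.card V + (supports T).ncard by
    have h' : (2 : ℝ) * (maxsepRB T : ℝ) ≤ Fintype.card V + (supports T).ncard := by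
      exact_mod_cast h
    linarith
  suffices h : maxsepRB T ≤ (Fintype.card V + (supports T).ncard) / 2 by omega
  refine csSup_le' ?_
  rintro _ ⟨c, rfl⟩
  obtain ⟨S, hS, hc⟩ := rb_main hT hn c
  have h1 : sepRB T c ≤ S.card := Nat.sInf_le ⟨S, rfl, hS⟩
  have h2 : sepRB T c ≤ (Fintype.card V + (supports T).ncard) / 2 := by omega
  exact h2
end

section
/- For any tree T of order n ≥ 5, sep(T) ≤ n − s(T), where s(T) is the number of support vertices of T. -/
theorem aux_cross {V : Type*} (T : SimpleGraph V) (hT : T.Connected) (A : Set V)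
    (a b : V) (ha : a ∈ A) (hb : b ∉ A) : ∃ x ∈ A, ∃ y, y ∉ A ∧ T.Adj x y := by
  obtain ⟨w⟩ := hT.preconnected a b
  obtain ⟨d, _, h1, h2⟩ := w.exists_boundary_dart A ha hb
  exact ⟨d.fst, h1, d.snd, h2, d.adj⟩

theorem aux_tri {V : Type*} (T : SimpleGraph V) (hT : T.IsAcyclic) (x y z : V)
    (h1 : T.Adj x y) (h2 : T.Adj y z) (h3 : T.Adj x z) : False := by
  have hc : (SimpleGraph.Walk.cons h1 (.cons h2 (.cons h3.symm .nil))).IsCycle := by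
    have a1 := h1.ne
    have a2 := h2.ne
    have a3 := h3.ne
    rw [SimpleGraph.Walk.cons_isCycle_iff]
    simp [SimpleGraph.Walk.cons_isPath_iff, a1, a2, a3, a1.symm, a2.symm, a3.symm]
  exact hT _ hc

theorem stmt15 {V : Type*} [Fintype V] (T : SimpleGraph V) (hT : T.IsTree)
    (hn : 5 ≤ Fintype.card V) :
    sepNum T ≤ Fintype.card V - (supports T).ncard := by
  classical
  have hcon := hT.connected
  have big : ∀ F : Finset V, F.card < 5 → ∃ b, b ∉ F := by
    intro F hF
    by_contra h
    push Not at h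
    have : F = Finset.univ := Finset.eq_univ_iff_forall.2 h
    rw [this, Finset.card_univ] at hF
    omega
  have hsl : ∀ v ∈ supports T, ¬ IsLeafVertex T v := by
    rintro v ⟨u, hvu, w, hw, hwu⟩ ⟨w', hw', hwu'⟩
    obtain ⟨b, hb⟩ := big {u, v} (lt_of_le_of_lt Finset.card_le_two (by norm_num))
    obtain ⟨x, hx, y, hy, hxy⟩ := aux_cross T hcon (({u, v} : Finset V) : Set V) u b (by simp) hb
    have e1 := hwu v hvu.symm
    have e2 := hwu' u hvu
    simp only [Finset.coe_insert, Finset.coe_singleton, Set.mem_insert_iff,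
      Set.mem_singleton_iff, not_or] at hx hy
    rcases hx with rfl | rfl
    · exact hy.2 ((hwu y hxy).trans e1.symm)
    · exact hy.1 ((hwu' y hxy).trans e2.symm)
  have hch : ∀ v : V, ∃ u, v ∈ supports T → T.Adj v u ∧ IsLeafVertex T u := by
    intro v
    by_cases h : v ∈ supports T
    · obtain ⟨u, hu⟩ := h
      exact ⟨u, fun _ => hu⟩
    · exact ⟨v, fun h' => absurd h' h⟩
  choose f hf using hch
  set P : Finset V := Finset.univ.filter (fun v => v ∈ supports T) with hP
  have memP : ∀ v, v ∈ P ↔ v ∈ supports T := by intro v; simp [hP]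
  have hPs : (supports T).ncard = P.card := by
    rw [← Set.ncard_coe_finset]
    congr 1
    ext v; simp [memP]
  set L : Finset V := P.image f with hL
  have uniq : ∀ v ∈ P, ∀ y, T.Adj (f v) y → y = v := by
    intro v hv y hy
    obtain ⟨h1, h2⟩ := hf v ((memP v).1 hv)
    exact h2.unique hy h1.symm
  have adjf : ∀ v ∈ P, T.Adj v (f v) := fun v hv => (hf v ((memP v).1 hv)).1
  have inj : Set.InjOn f P := by
    intro a ha b hb hab
    exact uniq b hb a (hab ▸ (adjf a ha).symm)
  have cL : L.card = P.card := Finset.card_image_of_injOn inj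
  have memL : ∀ u, u ∈ L ↔ ∃ v ∈ P, f v = u := by intro u; simp [hL]
  have PL : ∀ v ∈ P, v ∉ L := by
    intro v hv hvL
    obtain ⟨w, hw, rfl⟩ := (memL v).1 hvL
    exact hsl _ ((memP _).1 hv) (hf w ((memP w).1 hw)).2
  have c2 : P.card + L.card ≤ Fintype.card V := by
    rw [← Finset.card_union_of_disjoint (Finset.disjoint_left.2 PL)]
    exact Finset.card_le_univ _
  have cS : (Lᶜ).card = Fintype.card V - P.card := by
    rw [Finset.card_compl, cL]
  have key : ∀ A : Finset V, A.Nonempty → A ⊆ Lᶜ → A.card ≤ 2 →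
      ∃ a ∈ A, ∃ z, z ∉ A ∧ z ∉ L ∧ T.Adj a z := by
    intro A ⟨a0, ha0⟩ hA hc
    obtain ⟨b, hb, hbA⟩ : ∃ b ∈ Lᶜ, b ∉ A := by
      by_contra h
      push Not at h
      have := Finset.card_le_card (show Lᶜ ⊆ A from h)
      omega
    obtain ⟨x, hx, y, hy, hxy⟩ := aux_cross T hcon
      {u | u ∈ A ∨ ∃ v ∈ P, v ∈ A ∧ f v = u} a0 b (Or.inl ha0) (by
        rintro (h | ⟨v, hv, _, rfl⟩)
        · exact hbA h
        · exact (Finset.mem_compl.1 hb) ((memL _).2 ⟨v, hv, rfl⟩))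
    simp only [Set.mem_setOf_eq, not_or] at hx hy
    rcases hx with hx | ⟨v, hv, hvA, rfl⟩
    · refine ⟨x, hx, y, hy.1, ?_, hxy⟩
      intro hyL
      obtain ⟨v, hv, rfl⟩ := (memL y).1 hyL
      have := uniq v hv x hxy.symm
      subst this
      exact hy.2 ⟨x, hv, hx, rfl⟩
    · have := uniq v hv y hxy
      subst this
      exact absurd hvA hy.1
  have mem_iff : ∀ u v : V, closedNbhd T u ∩ ((Lᶜ : Finset V) : Set V) =
      closedNbhd T v ∩ ((Lᶜ : Finset V) : Set V) →
      ∀ z, z ∉ L → ((T.Adj u z ∨ z = u) ↔ (T.Adj v z ∨ z = v)) := by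
    intro u v h z hz
    have := Set.ext_iff.1 h z
    simpa [closedNbhd, hz] using this
  have nb : ∀ v ∉ L, ∃ z, z ∉ L ∧ T.Adj v z := by
    intro v hv
    obtain ⟨a, ha, z, _, hzL, hz⟩ := key {v} (by simp) (by simpa using hv) (by simp)
    rw [Finset.mem_singleton] at ha
    exact ⟨z, hzL, ha ▸ hz⟩
  have mixed : ∀ u ∈ L, ∀ v ∉ L, closedNbhd T u ∩ ((Lᶜ : Finset V) : Set V) ≠
      closedNbhd T v ∩ ((Lᶜ : Finset V) : Set V) := by
    intro u hu v hv h
    obtain ⟨p, hp, rfl⟩ := (memL u).1 hu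
    obtain ⟨z, hzL, hz⟩ := nb v hv
    have one : ∀ y, y ∉ L → (T.Adj v y ∨ y = v) → y = p := by
      intro y hy h'
      rcases (mem_iff _ _ h y hy).2 h' with h' | h'
      · exact uniq p hp y h'
      · exact absurd (h' ▸ hu) hy
    exact hz.ne ((one v hv (Or.inr rfl)).trans (one z hzL (Or.inl hz)).symm)
  rw [hPs]
  refine Nat.sInf_le ⟨Lᶜ, cS, ?_⟩
  intro u v huv h
  by_cases hu : u ∈ L
  · by_cases hv : v ∈ L
    · obtain ⟨p, hp, rfl⟩ := (memL u).1 hu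
      obtain ⟨q, hq, rfl⟩ := (memL v).1 hv
      rcases (mem_iff _ _ h p (PL p hp)).1 (Or.inl (adjf p hp).symm) with h' | h'
      · exact huv (congrArg f (uniq q hq p h'))
      · exact PL p hp (h' ▸ hv)
    · exact mixed u hu v hv h
  · by_cases hv : v ∈ L
    · exact mixed v hv u hu h.symm
    · have M := mem_iff _ _ h
      have huv' : T.Adj u v := by
        rcases (M v hv).2 (Or.inr rfl) with h' | h'
        · exact h'
        · exact absurd h'.symm huv
      obtain ⟨a, ha, z, hzA, hzL, hz⟩ := key {u, v} (by simp) (by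
        intro y hy
        simp only [Finset.mem_insert, Finset.mem_singleton] at hy
        rcases hy with rfl | rfl <;> simpa) Finset.card_le_two
      simp only [Finset.mem_insert, Finset.mem_singleton, not_or] at ha hzA
      have Mz := M z hzL
      have : T.Adj u z ∧ T.Adj v z := by
        rcases ha with rfl | rfl
        · exact ⟨hz, (Mz.1 (Or.inl hz)).resolve_right hzA.2⟩
        · exact ⟨(Mz.2 (Or.inl hz)).resolve_right hzA.1, hz⟩
      exact aux_tri T hT.IsAcyclic u v z huv' this.2 this.1
end
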